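/- If K₅ × S¹ embeds into ℝ³, then K₅ × K₅ embeds into ℝ⁴; consequently, since K₅ × K₅ does not embed into ℝ⁴, the product K₅ × S¹ does not embed into ℝ³. -/

import Mathlib

open Set

noncomputable section

/-- The point of `ℝ^V` corresponding to a vertex `v` of a graph. -/
def vert {V : Type*} [DecidableEq V] (v : V) : V → ℝ := fun i => if i = v then 1 else 0

/-- Geometric realization of a simple graph as a subset of `ℝ^V`:
the union of the straight segments joining the standard points of adjacent vertices. -/
def graphRealization {V : Type*} [DecidableEq V] (G : SimpleGraph V) : Set (V → ℝ) :=
  ⋃ p : {p : V × V // G.Adj p.1 p.2}, segment ℝ (vert p.1.1) (vert p.1.2)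

/-- A (compact) polyhedron: a finite union of polytopes (convex hulls of finite sets). -/
def IsPolyhedron {E : Type*} [AddCommGroup E] [Module ℝ E] (s : Set E) : Prop :=
  ∃ T : Set (Set E), T.Finite ∧ (∀ P ∈ T, ∃ Q : Set E, Q.Finite ∧ P = convexHull ℝ Q) ∧
    s = ⋃₀ T

/-- `f` is piecewise linear (PL) on `s`: there is a finite family of polytopes covering `s`
on each of which `f` coincides with an affine map. -/
def IsPLOn {E F : Type*} [AddCommGroup E] [Module ℝ E] [AddCommGroup F] [Module ℝ F]
    (f : E → F) (s : Set E) : Prop :=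
  ∃ T : Set (Set E), T.Finite ∧ (∀ P ∈ T, ∃ Q : Set E, Q.Finite ∧ P = convexHull ℝ Q) ∧
    s ⊆ ⋃₀ T ∧ ∀ P ∈ T, ∃ g : E →ᵃ[ℝ] F, EqOn f g (P ∩ s)

/-- The cone over a set `A` with apex `p` (union of segments from `p` to points of `A`). -/
def coneFrom {E : Type*} [AddCommGroup E] [Module ℝ E] (p : E) (A : Set E) : Set E :=
  ⋃ x ∈ A, segment ℝ p x

/-- Cells of the integer grid in dimension three. An even coordinate stands for a vertex of the
line, an odd one for the open edge between its two neighbours. -/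
abbrev Cell := Fin 3 → ℤ

/-- Locally finite mod 2 cubical chains of the grid (no support condition). -/
abbrev Chain := Cell → ZMod 2

/-- The part of the boundary operator in direction `i`. -/
def bdDir (i : Fin 3) : Chain →ₗ[ZMod 2] Chain where
  toFun z c := if Even (c i) then
    z (Function.update c i (c i + 1)) + z (Function.update c i (c i - 1)) else 0
  map_add' x y := by
    funext c; by_cases h : Even (c i) <;> simp [h]; ring
  map_smul' a x := by
    funext c; by_cases h : Even (c i) <;> simp [h]; ring

/-- The boundary operator on chains. -/
def bdC : Chain →ₗ[ZMod 2] Chain := bdDir 0 + bdDir 1 + bdDir 2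

lemma bdDir_apply (i : Fin 3) (z : Chain) (c : Cell) : bdDir i z c = if Even (c i) then
    z (Function.update c i (c i + 1)) + z (Function.update c i (c i - 1)) else 0 := rfl

lemma bdDir_self (i : Fin 3) (z : Chain) : bdDir i (bdDir i z) = 0 := by
  funext c
  by_cases h : Even (c i)
  · simp [bdDir_apply, h, Int.not_odd_iff_even.2 h]
  · simp [bdDir_apply, h]

lemma bdDir_comm {i j : Fin 3} (hij : i ≠ j) (z : Chain) :
    bdDir i (bdDir j z) = bdDir j (bdDir i z) := by
  funext c
  by_cases h : Even (c i) <;> by_cases h' : Even (c j) <;>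
    simp [bdDir_apply, h, h', hij, hij.symm, Function.update_comm hij]
  ring

lemma bdC_apply (z : Chain) : bdC z = bdDir 0 z + bdDir 1 z + bdDir 2 z := rfl

lemma bdC_bdC (z : Chain) : bdC (bdC z) = 0 := by
  simp only [bdC_apply, map_add, bdDir_self]
  rw [bdDir_comm (show (1 : Fin 3) ≠ 0 by decide), bdDir_comm (show (2 : Fin 3) ≠ 0 by decide),
    bdDir_comm (show (2 : Fin 3) ≠ 1 by decide)]
  have h (x : Chain) : x + x = 0 := by funext c; exact CharTwo.add_self_eq_zero _
  calc _ = (bdDir 0 (bdDir 1 z) + bdDir 0 (bdDir 1 z)) +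
        (bdDir 0 (bdDir 2 z) + bdDir 0 (bdDir 2 z)) +
        (bdDir 1 (bdDir 2 z) + bdDir 1 (bdDir 2 z)) := by abel
    _ = 0 := by simp only [h]

/-- The coarse coordinate of which a fine coordinate is a part. -/
def parent (b : ℤ) : ℤ := if b % 4 = 1 then (b + 1) / 2 else b / 2

/-- Subdivision of chains: every cell is replaced by the cells of the same dimension
of the grid of half the mesh size. -/
def sd : Chain →ₗ[ZMod 2] Chain where
  toFun z c := if ∃ i, c i % 4 = 2 then 0 else z (fun i => parent (c i))
  map_add' x y := by
    funext c
    by_cases h : ∃ i, c i % 4 = 2 <;>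
      simp only [h, Pi.add_apply, if_true, if_false, add_zero]
  map_smul' a x := by funext c; by_cases h : ∃ i, c i % 4 = 2 <;> simp [h]

lemma sd_apply (z : Chain) (c : Cell) :
    sd z c = if ∃ i, c i % 4 = 2 then 0 else z (fun i => parent (c i)) := rfl

lemma parent_update (c : Cell) (i : Fin 3) (b : ℤ) :
    (fun j => parent (Function.update c i b j)) =
      Function.update (fun j => parent (c j)) i (parent b) := by
  funext j; by_cases h : j = i
  · subst h; simp
  · simp [h]

lemma exists_update_mod (c : Cell) (i : Fin 3) (b : ℤ) :
    (∃ j, Function.update c i b j % 4 = 2) ↔ b % 4 = 2 ∨ ∃ j, j ≠ i ∧ c j % 4 = 2 := by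
  constructor
  · rintro ⟨j, hj⟩
    by_cases h : j = i
    · subst h; left; simpa using hj
    · right; exact ⟨j, h, by simpa [h] using hj⟩
  · rintro (h | ⟨j, h, hj⟩)
    · exact ⟨i, by simpa using h⟩
    · exact ⟨j, by simpa [h] using hj⟩

lemma sd_bdDir (i : Fin 3) (z : Chain) : sd (bdDir i z) = bdDir i (sd z) := by
  funext c
  have key : (∃ j, c j % 4 = 2) ↔ c i % 4 = 2 ∨ ∃ j, j ≠ i ∧ c j % 4 = 2 := by
    simpa using exists_update_mod c i (c i)
  rw [sd_apply, bdDir_apply, bdDir_apply]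
  simp only [sd_apply, exists_update_mod, parent_update, key]
  by_cases h : ∃ j, j ≠ i ∧ c j % 4 = 2
  · simp [h]
  · simp only [h, or_false]
    have h4 : c i % 4 = 0 ∨ c i % 4 = 1 ∨ c i % 4 = 2 ∨ c i % 4 = 3 := by omega
    rcases h4 with h4 | h4 | h4 | h4
    · have e0 : Even (c i) := by rw [Int.even_iff]; omega
      have e1 : parent (c i) = c i / 2 := by unfold parent; rw [if_neg (by omega)]
      have e2 : parent (c i + 1) = c i / 2 + 1 := by unfold parent; rw [if_pos (by omega)]; omega
      have e3 : parent (c i - 1) = c i / 2 - 1 := by unfold parent; rw [if_neg (by omega)]; omega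
      rw [if_neg (by omega), if_pos (by rw [e1, Int.even_iff]; omega), if_pos e0,
        if_neg (by omega), if_neg (by omega), e1, e2, e3]
    · have e1 : parent (c i) = (c i + 1) / 2 := by unfold parent; rw [if_pos (by omega)]
      rw [if_neg (by omega), if_neg (by rw [e1, Int.even_iff]; omega),
        if_neg (by rw [Int.even_iff]; omega)]
    · have e0 : Even (c i) := by rw [Int.even_iff]; omega
      have e2 : parent (c i + 1) = c i / 2 := by unfold parent; rw [if_neg (by omega)]; omega
      have e3 : parent (c i - 1) = c i / 2 := by unfold parent; rw [if_pos (by omega)]; omega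
      rw [if_pos h4, if_pos e0, if_neg (by omega), if_neg (by omega), e2, e3,
        CharTwo.add_self_eq_zero]
    · have e1 : parent (c i) = c i / 2 := by unfold parent; rw [if_neg (by omega)]
      rw [if_neg (by omega), if_neg (by rw [e1, Int.even_iff]; omega),
        if_neg (by rw [Int.even_iff]; omega)]

lemma sd_bdC (z : Chain) : sd (bdC z) = bdC (sd z) := by
  simp only [bdC_apply, map_add, sd_bdDir]

lemma sd_injective : Function.Injective sd := by
  rw [injective_iff_map_eq_zero]
  intro z hz
  funext c
  have := congrFun hz (fun i => if Even (c i) then 2 * c i else 2 * c i + 1)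
  rw [sd_apply, if_neg] at this
  · rw [show z c = z (fun i => parent (if Even (c i) then 2 * c i else 2 * c i + 1)) from ?_]
    · exact this
    · congr 1
      funext i
      simp only [parent]
      split_ifs with h h1 h1 <;> grind
  · rintro ⟨i, hi⟩
    split_ifs at hi with h <;> grind

/-- The dimension of a cell. -/
def cellDim (c : Cell) : ℕ := (Finset.univ.filter fun i => Odd (c i)).card

/-- Projection of a chain to its part of dimension `k`. -/
def projC (k : ℕ) : Chain →ₗ[ZMod 2] Chain where
  toFun z c := if cellDim c = k then z c else 0
  map_add' x y := by funext c; by_cases h : cellDim c = k <;> simp [h]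
  map_smul' a x := by funext c; by_cases h : cellDim c = k <;> simp [h]

lemma projC_apply (k : ℕ) (z : Chain) (c : Cell) :
    projC k z c = if cellDim c = k then z c else 0 := rfl

lemma cellDim_update {c : Cell} {i : Fin 3} {b : ℤ} (h : Even (c i)) (hb : Odd b) :
    cellDim (Function.update c i b) = cellDim c + 1 := by
  have : (Finset.univ.filter fun j => Odd (Function.update c i b j)) =
      insert i (Finset.univ.filter fun j => Odd (c j)) := by
    ext j
    by_cases hj : j = i
    · subst hj; simp [hb]
    · simp [hj]
  unfold cellDim
  rw [this, Finset.card_insert_of_notMem]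
  simpa using h

lemma bdDir_projC (i : Fin 3) (k : ℕ) (z : Chain) :
    bdDir i (projC (k + 1) z) = projC k (bdDir i z) := by
  funext c
  rw [projC_apply, bdDir_apply, bdDir_apply]
  by_cases h : Even (c i)
  · simp only [h, if_true, projC_apply, cellDim_update h h.add_one, cellDim_update h (h.sub_odd odd_one),
      add_left_inj]
    split_ifs <;> simp
  · simp [h]

lemma bdC_projC (k : ℕ) (z : Chain) : bdC (projC (k + 1) z) = projC k (bdC z) := by
  simp only [bdC_apply, map_add, bdDir_projC]

lemma sd_projC (k : ℕ) (z : Chain) : sd (projC k z) = projC k (sd z) := by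
  funext c
  rw [projC_apply, sd_apply, sd_apply]
  by_cases h : ∃ i, c i % 4 = 2
  · simp [h]
  · have : cellDim (fun i => parent (c i)) = cellDim c := by
      unfold cellDim
      refine congrArg Finset.card (Finset.filter_congr fun i _ => ?_)
      change Odd (parent (c i)) ↔ _
      unfold parent
      have hi : ¬ c i % 4 = 2 := fun hi => h ⟨i, hi⟩
      rw [Int.odd_iff, Int.odd_iff]
      split_ifs <;> omega
    simp [h, projC_apply, this]

lemma projC_projC (k : ℕ) (z : Chain) : projC k (projC k z) = projC k z := by
  funext c; simp only [projC_apply]; split_ifs <;> rfl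

/-- The sum of all three-dimensional cells. -/
def omegaC : Chain := fun c => if ∀ i, Odd (c i) then 1 else 0

lemma sd_omegaC : sd omegaC = omegaC := by
  funext c
  rw [sd_apply]
  unfold omegaC
  by_cases h : ∃ i, c i % 4 = 2
  · rw [if_pos h, if_neg]
    obtain ⟨i, hi⟩ := h
    intro h; have := h i; rw [Int.odd_iff] at this; omega
  · rw [if_neg h]
    congr 1
    rw [eq_iff_iff]
    refine forall_congr' fun i => ?_
    have hi : ¬ c i % 4 = 2 := fun hi => h ⟨i, hi⟩
    simp only [parent]
    rw [Int.odd_iff, Int.odd_iff]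
    split_ifs <;> omega

lemma bdC_eq_zero_of_odd (z : Chain) {c : Cell} (h : ∀ i, Odd (c i)) : bdC z c = 0 := by
  have h' : ∀ i, ¬ Even (c i) := fun i => by simpa using h i
  simp [bdC_apply, bdDir_apply, h']

lemma bdC_omegaC : bdC omegaC = 0 := by
  have (i : Fin 3) : bdDir i omegaC = 0 := by
    funext c
    rw [bdDir_apply]
    by_cases h : Even (c i)
    · rw [if_pos h]
      have h1 (b : ℤ) (hb : Odd b) : (∀ j, Odd (Function.update c i b j)) ↔
          ∀ j, j ≠ i → Odd (c j) := by
        refine forall_congr' fun j => ?_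
        by_cases hj : j = i
        · subst hj; simp [hb]
        · simp [hj]
      unfold omegaC
      rw [if_congr (h1 _ h.add_one) rfl rfl, if_congr (h1 _ (h.sub_odd odd_one)) rfl rfl,
        CharTwo.add_self_eq_zero]
      rfl
    · simp [h]
  simp [bdC_apply, this]

lemma projC_omegaC : projC 3 omegaC = omegaC := by
  funext c
  rw [projC_apply]
  unfold omegaC
  by_cases h : ∀ i, Odd (c i)
  · have : cellDim c = 3 := by unfold cellDim; rw [Finset.filter_true_of_mem (by simpa using h)]; rfl
    simp [this]
  · simp [h]

/-- Mod 2 primitive with base point `t` of a function on the even integers. -/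
def prim (t : ℤ) (f : ℤ → ZMod 2) (c : ℤ) : ZMod 2 :=
  ∑ b ∈ (Finset.Ioo (min t c) (max t c)).filter Even, f b

lemma prim_step {t c : ℤ} (ht : Odd t) (hc : Even c) (f : ℤ → ZMod 2) :
    prim t f (c + 1) + prim t f (c - 1) = f c := by
  unfold prim
  rcases lt_or_ge t c with h | h
  · have : (Finset.Ioo (min t (c + 1)) (max t (c + 1))).filter Even =
        insert c ((Finset.Ioo (min t (c - 1)) (max t (c - 1))).filter Even) := by
      ext b; simp only [Finset.mem_filter, Finset.mem_Ioo, Finset.mem_insert]; grind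
    rw [this, Finset.sum_insert (by simp; omega), add_assoc, CharTwo.add_self_eq_zero, add_zero]
  · have : (Finset.Ioo (min t (c - 1)) (max t (c - 1))).filter Even =
        insert c ((Finset.Ioo (min t (c + 1)) (max t (c + 1))).filter Even) := by
      ext b; simp only [Finset.mem_filter, Finset.mem_Ioo, Finset.mem_insert]; grind
    rw [this, Finset.sum_insert (by simp; omega), add_left_comm, CharTwo.add_self_eq_zero, add_zero]

lemma prim_telescope {t c : ℤ} (ht : Odd t) (hc : Odd c) (g : ℤ → ZMod 2) :
    prim t (fun b => g (b + 1) + g (b - 1)) c = g c + g t := by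
  have key (k : ℤ) : prim t (fun b => g (b + 1) + g (b - 1)) (t + 2 * k) = g (t + 2 * k) + g t := by
    induction k using Int.induction_on with
    | zero => simp [prim, CharTwo.add_self_eq_zero]
    | succ k ih =>
      have := prim_step ht (show Even (t + 2 * k + 1) by grind) (fun b => g (b + 1) + g (b - 1))
      rw [show t + 2 * (k : ℤ) + 1 + 1 = t + 2 * (k + 1) by ring,
        show t + 2 * (k : ℤ) + 1 - 1 = t + 2 * k by ring, ih] at this
      grind
    | pred k ih =>
      have := prim_step ht (show Even (t + 2 * (-(k : ℤ)) - 1) by grind)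
        (fun b => g (b + 1) + g (b - 1))
      rw [show t + 2 * (-(k : ℤ)) - 1 + 1 = t + 2 * (-k) by ring,
        show t + 2 * (-(k : ℤ)) - 1 - 1 = t + 2 * (-k - 1) by ring, ih] at this
      grind
  obtain ⟨k, hk⟩ : ∃ k, c = t + 2 * k := by
    obtain ⟨a, rfl⟩ := ht; obtain ⟨b, rfl⟩ := hc; exact ⟨b - a, by ring⟩
  rw [hk]; exact key k

/-- The contraction of the grid in direction `i` towards the coordinate `t`. -/
def contractDir (i : Fin 3) (t : ℤ) : Chain →ₗ[ZMod 2] Chain where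
  toFun z c := if Odd (c i) then prim t (fun b => z (Function.update c i b)) (c i) else 0
  map_add' x y := by
    funext c; by_cases h : Odd (c i) <;> simp [h, prim, Finset.sum_add_distrib]
  map_smul' a x := by
    funext c; by_cases h : Odd (c i) <;> simp [h, prim, Finset.mul_sum]

/-- The part of a chain in the slab over `t`, spread out in direction `i`. -/
def spreadDir (i : Fin 3) (t : ℤ) (z : Chain) : Chain :=
  fun c => if Odd (c i) then z (Function.update c i t) else 0

lemma contractDir_apply (i : Fin 3) (t : ℤ) (z : Chain) (c : Cell) : contractDir i t z c =
    if Odd (c i) then prim t (fun b => z (Function.update c i b)) (c i) else 0 := rfl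

lemma bdDir_contractDir_self {t : ℤ} (ht : Odd t) (i : Fin 3) (z : Chain) :
    bdDir i (contractDir i t z) + contractDir i t (bdDir i z) = z + spreadDir i t z := by
  funext c
  rw [Pi.add_apply, Pi.add_apply, bdDir_apply, spreadDir]
  by_cases h : Even (c i)
  · have h' : ¬ Odd (c i) := by simpa using h
    have := prim_step ht h (fun b => z (Function.update c i b))
    simpa [h, h', contractDir_apply, h.add_one, h.sub_odd odd_one] using this
  · have h' : Odd (c i) := by simpa using h
    have := prim_telescope ht h' (fun b => z (Function.update c i b))
    rw [Function.update_eq_self] at this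
    rw [if_neg h, if_pos h', contractDir_apply, if_pos h', zero_add, ← this]
    unfold prim
    refine Finset.sum_congr rfl fun b hb => ?_
    simp [bdDir_apply, (Finset.mem_filter.1 hb).2]

lemma bdDir_contractDir {i j : Fin 3} (hij : j ≠ i) (t : ℤ) (z : Chain) :
    bdDir j (contractDir i t z) = contractDir i t (bdDir j z) := by
  funext c
  rw [bdDir_apply, contractDir_apply]
  by_cases h : Even (c j) <;> by_cases h' : Odd (c i) <;>
    simp [contractDir_apply, bdDir_apply, h, h', hij, hij.symm, prim, Finset.sum_add_distrib,
      Function.update_comm hij]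

lemma bdC_eq_sum (z : Chain) : bdC z = ∑ j, bdDir j z := by
  rw [Fin.sum_univ_three]; rfl

lemma bdC_contractDir {t : ℤ} (ht : Odd t) (i : Fin 3) (z : Chain) :
    bdC (contractDir i t z) + contractDir i t (bdC z) = z + spreadDir i t z := by
  rw [← bdDir_contractDir_self ht, bdC_eq_sum, bdC_eq_sum, map_sum,
    ← Finset.add_sum_erase _ _ (Finset.mem_univ i),
    ← Finset.add_sum_erase _ (fun j => contractDir i t (bdDir j z)) (Finset.mem_univ i),
    Finset.sum_congr rfl fun j hj => bdDir_contractDir (Finset.ne_of_mem_erase hj) t z]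
  set S := ∑ j ∈ Finset.univ.erase i, contractDir i t (bdDir j z)
  have : S + S = 0 := by funext c; exact CharTwo.add_self_eq_zero _
  calc _ = (S + S) + (bdDir i (contractDir i t z) + contractDir i t (bdDir i z)) := by abel
    _ = _ := by rw [this, zero_add]

lemma bdC_spreadDir {t : ℤ} (ht : Odd t) (i : Fin 3) (z : Chain) :
    bdC (spreadDir i t z) = spreadDir i t (bdC z) := by
  have h1 := congrArg bdC (bdC_contractDir ht i z)
  have h2 := bdC_contractDir ht i (bdC z)
  rw [map_add, map_add, bdC_bdC, zero_add] at h1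
  rw [bdC_bdC, map_zero, add_zero] at h2
  exact add_left_cancel (h1.symm.trans h2)

/-- A grid interval: a convex set of coordinates containing an odd number and with every even
number its two neighbours. -/
structure GridInterval (I : Set ℤ) (t : ℤ) : Prop where
  ordConnected : I.OrdConnected
  mem : t ∈ I
  odd : Odd t
  add_mem : ∀ b ∈ I, Even b → b + 1 ∈ I
  sub_mem : ∀ b ∈ I, Even b → b - 1 ∈ I

lemma gridInterval_univ : GridInterval univ 1 :=
  ⟨ordConnected_univ, trivial, odd_one, fun _ _ _ => trivial, fun _ _ _ => trivial⟩

lemma eq_bdC_contractDir_add_spreadDir {I : Fin 3 → Set ℤ} {t : ℤ} {i : Fin 3}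
    (hI : GridInterval (I i) t) {z : Chain}
    (hz : ∀ c : Cell, (∀ j, c j ∈ I j) → bdC z c = 0) {c : Cell} (hc : ∀ j, c j ∈ I j) :
    z c = bdC (contractDir i t z) c + spreadDir i t z c := by
  have h := congrFun (bdC_contractDir hI.odd i z) c
  have h0 : contractDir i t (bdC z) c = 0 := by
    rw [contractDir_apply]
    split_ifs with ho
    · refine Finset.sum_eq_zero fun b hb => hz _ fun j => ?_
      by_cases hj : j = i
      · subst hj
        rw [Function.update_self]
        have hb := Finset.mem_Ioo.1 (Finset.mem_filter.1 hb).1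
        rcases le_total t (c j) with h' | h'
        · rw [min_eq_left h', max_eq_right h'] at hb
          exact hI.ordConnected.out hI.mem (hc j) ⟨hb.1.le, hb.2.le⟩
        · rw [min_eq_right h', max_eq_left h'] at hb
          exact hI.ordConnected.out (hc j) hI.mem ⟨hb.1.le, hb.2.le⟩
      · simpa [hj] using hc j
    · rfl
  rw [Pi.add_apply, h0, add_zero, Pi.add_apply] at h
  rw [h, add_assoc, CharTwo.add_self_eq_zero, add_zero]

lemma bdC_spreadDir_eq_zero {I : Fin 3 → Set ℤ} {t : ℤ} {i : Fin 3}
    (hI : GridInterval (I i) t) {z : Chain}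
    (hz : ∀ c : Cell, (∀ j, c j ∈ I j) → bdC z c = 0) (c : Cell) (hc : ∀ j, c j ∈ I j) :
    bdC (spreadDir i t z) c = 0 := by
  rw [bdC_spreadDir hI.odd, spreadDir]
  split_ifs with ho
  · refine hz _ fun j => ?_
    by_cases hj : j = i
    · subst hj; simpa using hI.mem
    · simpa [hj] using hc j
  · rfl

/-- Every cycle of a box relative to its boundary is, up to a boundary, a multiple of the
sum of all three-dimensional cells. -/
lemma exists_eq_bdC_add_omegaC {I : Fin 3 → Set ℤ} {t : Fin 3 → ℤ}
    (hI : ∀ i, GridInterval (I i) (t i)) {z : Chain}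
    (hz : ∀ c : Cell, (∀ j, c j ∈ I j) → bdC z c = 0) :
    ∃ (w : Chain) (a : ZMod 2), ∀ c : Cell, (∀ j, c j ∈ I j) →
      z c = bdC w c + a * omegaC c := by
  have h1 := bdC_spreadDir_eq_zero (hI 0) hz
  have h2 := bdC_spreadDir_eq_zero (hI 1) h1
  refine ⟨contractDir 0 (t 0) z + contractDir 1 (t 1) (spreadDir 0 (t 0) z) +
    contractDir 2 (t 2) (spreadDir 1 (t 1) (spreadDir 0 (t 0) z)), z t, fun c hc => ?_⟩
  have e0 := eq_bdC_contractDir_add_spreadDir (hI 0) hz hc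
  have e1 := eq_bdC_contractDir_add_spreadDir (hI 1) h1 hc
  have e2 := eq_bdC_contractDir_add_spreadDir (hI 2) h2 hc
  have e3 : spreadDir 2 (t 2) (spreadDir 1 (t 1) (spreadDir 0 (t 0) z)) c = z t * omegaC c := by
    have : Function.update (Function.update (Function.update c 2 (t 2)) 1 (t 1)) 0 (t 0) = t := by
      funext j; fin_cases j <;> simp [Function.update]
    simp only [spreadDir, omegaC, Function.update_apply, Fin.forall_fin_succ]
    by_cases h0 : Odd (c 0) <;> by_cases h1 : Odd (c 1) <;> by_cases h2 : Odd (c 2) <;>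
      simp [h0, h1, h2, this]
  rw [map_add, map_add, Pi.add_apply, Pi.add_apply, e0, e1, e2, e3]
  ring

/-- Iterated subdivision. -/
def sdPow (i j : ℕ) (_ : i ≤ j) : Chain →ₗ[ZMod 2] Chain := sd ^ (j - i)

instance : DirectedSystem (fun _ : ℕ => Chain) (fun i j h => sdPow i j h) where
  map_self i x := by simp [sdPow]
  map_map i j k hij hjk x := by
    simp only [sdPow]
    rw [← Module.End.mul_apply, ← pow_add]
    congr 2
    omega

/-- Dyadic cubical chains of `ℝ³`: chains of the grids of mesh size `2 ^ (1 - n)`, a chain being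
identified with its subdivisions. -/
abbrev DyadicChain : Type := Module.DirectLimit (fun _ : ℕ => Chain) sdPow

/-- The dyadic chain defined by a chain of the grid of level `n`. -/
def lev (n : ℕ) : Chain →ₗ[ZMod 2] DyadicChain := Module.DirectLimit.of (ZMod 2) ℕ _ sdPow n

lemma lev_sdPow {n m : ℕ} (h : n ≤ m) (z : Chain) : lev m (sdPow n m h z) = lev n z :=
  Module.DirectLimit.of_f

lemma lev_sd (n : ℕ) (z : Chain) : lev (n + 1) (sd z) = lev n z := by
  rw [← lev_sdPow (Nat.le_succ n)]; simp [sdPow]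

lemma sdPow_injective {n m : ℕ} (h : n ≤ m) : Function.Injective (sdPow n m h) := by
  unfold sdPow
  rw [Module.End.coe_pow]
  exact sd_injective.iterate _

lemma lev_injective (n : ℕ) : Function.Injective (lev n) := by
  rw [injective_iff_map_eq_zero]
  intro z hz
  obtain ⟨m, h, hm⟩ := Module.DirectLimit.of.zero_exact hz
  exact sdPow_injective h (hm.trans (map_zero _).symm)

lemma exists_lev (z : DyadicChain) : ∃ n x, lev n x = z := Module.DirectLimit.exists_of z

/-- Extension to dyadic chains of an operator commuting with subdivision. -/
def extendOp (T : Chain →ₗ[ZMod 2] Chain) (hT : ∀ z, sd (T z) = T (sd z)) :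
    DyadicChain →ₗ[ZMod 2] DyadicChain :=
  Module.DirectLimit.map (fun _ => T) fun i j h => by
    ext1 z
    simp only [sdPow, LinearMap.comp_apply]
    generalize j - i = k
    induction k with
    | zero => simp
    | succ k ih => rw [pow_succ', Module.End.mul_apply, Module.End.mul_apply, ← hT, ih]

lemma extendOp_lev (T : Chain →ₗ[ZMod 2] Chain) (hT : ∀ z, sd (T z) = T (sd z)) (n : ℕ)
    (z : Chain) : extendOp T hT (lev n z) = lev n (T z) :=
  Module.DirectLimit.map_apply_of _ _ _

/-- The boundary operator on dyadic chains. -/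
def bd : DyadicChain →ₗ[ZMod 2] DyadicChain := extendOp bdC sd_bdC

/-- Projection of a dyadic chain to its part of dimension `k`. -/
def proj (k : ℕ) : DyadicChain →ₗ[ZMod 2] DyadicChain := extendOp (projC k) (sd_projC k)

lemma bd_lev (n : ℕ) (z : Chain) : bd (lev n z) = lev n (bdC z) := extendOp_lev _ _ _ _

lemma proj_lev (k n : ℕ) (z : Chain) : proj k (lev n z) = lev n (projC k z) :=
  extendOp_lev _ _ _ _

lemma bd_bd (z : DyadicChain) : bd (bd z) = 0 := by
  obtain ⟨n, x, rfl⟩ := exists_lev z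
  rw [bd_lev, bd_lev, bdC_bdC, map_zero]

lemma bd_proj (k : ℕ) (z : DyadicChain) : bd (proj (k + 1) z) = proj k (bd z) := by
  obtain ⟨n, x, rfl⟩ := exists_lev z
  rw [bd_lev, proj_lev, proj_lev, bd_lev, bdC_projC]

lemma proj_proj (k : ℕ) (z : DyadicChain) : proj k (proj k z) = proj k z := by
  obtain ⟨n, x, rfl⟩ := exists_lev z
  rw [proj_lev, proj_lev, projC_projC]

/-- The closed cube of `ℝ³` of the cell `c` of the grid of level `n`. -/
def cube (n : ℕ) (c : Cell) : Set (Fin 3 → ℝ) :=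
  {x | ∀ i, |2 ^ n * x i - c i| ≤ if Odd (c i) then 1 else 0}

lemma isClosed_cube (n : ℕ) (c : Cell) : IsClosed (cube n c) := by
  unfold cube
  simp only [Set.ofPred_forall]
  exact isClosed_iInter fun i => isClosed_le (by fun_prop) continuous_const

lemma abs_le_one_of_mem_cube {n : ℕ} {c : Cell} {x : Fin 3 → ℝ} (hx : x ∈ cube n c) (i : Fin 3) :
    |2 ^ n * x i - c i| ≤ 1 := (hx i).trans (by split_ifs <;> norm_num)

lemma dist_le_of_mem_cube {n : ℕ} {c : Cell} {x y : Fin 3 → ℝ} (hx : x ∈ cube n c)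
    (hy : y ∈ cube n c) : dist x y ≤ 2 / 2 ^ n := by
  refine (dist_pi_le_iff (by positivity)).2 fun i => ?_
  have h1 := abs_le.1 (abs_le_one_of_mem_cube hx i)
  have h2 := abs_le.1 (abs_le_one_of_mem_cube hy i)
  have h3 : |(x i - y i) * 2 ^ n| ≤ 2 := by rw [abs_le]; constructor <;> linarith
  rwa [abs_mul, abs_of_pos (show (0 : ℝ) < 2 ^ n by positivity), ← Real.dist_eq,
    ← le_div_iff₀ (by positivity)] at h3

lemma cube_update_subset (n : ℕ) {c : Cell} {i : Fin 3} (h : Even (c i)) {b : ℤ}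
    (hb : b = c i + 1 ∨ b = c i - 1) : cube n c ⊆ cube n (Function.update c i b) := by
  intro x hx j
  by_cases hj : j = i
  · subst hj
    have h1 := hx j
    rw [if_neg (by simpa using h), abs_nonpos_iff] at h1
    have hb' : Odd b := by rcases hb with rfl | rfl; exacts [h.add_one, h.sub_odd odd_one]
    rw [Function.update_self, if_pos hb']
    rcases hb with rfl | rfl <;> push_cast <;> rw [abs_le] <;> constructor <;> linarith
  · simpa [hj] using hx j

lemma cube_succ_subset (n : ℕ) {c : Cell} (h : ¬ ∃ i, c i % 4 = 2) :
    cube (n + 1) c ⊆ cube n (fun i => parent (c i)) := by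
  intro x hx i
  change |2 ^ n * x i - (parent (c i) : ℤ)| ≤ if Odd (parent (c i)) then 1 else 0
  have h1 := hx i
  have hi : ¬ c i % 4 = 2 := fun hi => h ⟨i, hi⟩
  have h4 : c i % 4 = 0 ∨ c i % 4 = 1 ∨ c i % 4 = 3 := by omega
  rw [pow_succ] at h1
  rcases h4 with h4 | h4 | h4
  · obtain ⟨k, hk⟩ : ∃ k, c i = 4 * k := ⟨c i / 4, by omega⟩
    have hp : parent (c i) = 2 * k := by unfold parent; rw [if_neg (by omega)]; omega
    rw [if_neg (by rw [Int.odd_iff]; omega), abs_nonpos_iff, hk] at h1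
    rw [hp, if_neg (by rw [Int.odd_iff]; omega), abs_nonpos_iff]
    push_cast at *
    linarith
  · obtain ⟨k, hk⟩ : ∃ k, c i = 4 * k + 1 := ⟨c i / 4, by omega⟩
    have hp : parent (c i) = 2 * k + 1 := by unfold parent; rw [if_pos (by omega)]; omega
    rw [if_pos (by rw [Int.odd_iff]; omega), abs_le, hk] at h1
    rw [hp, if_pos (by rw [Int.odd_iff]; omega), abs_le]
    push_cast at *
    constructor <;> linarith
  · obtain ⟨k, hk⟩ : ∃ k, c i = 4 * k + 3 := ⟨c i / 4, by omega⟩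
    have hp : parent (c i) = 2 * k + 1 := by unfold parent; rw [if_neg (by omega)]; omega
    rw [if_pos (by rw [Int.odd_iff]; omega), abs_le, hk] at h1
    rw [hp, if_pos (by rw [Int.odd_iff]; omega), abs_le]
    push_cast at *
    constructor <;> linarith

lemma finite_cube_inter (n : ℕ) {A : Set (Fin 3 → ℝ)} (hA : Bornology.IsBounded A) :
    {c | (cube n c ∩ A).Nonempty}.Finite := by
  obtain ⟨R, hR⟩ := hA.subset_closedBall 0
  refine (Set.finite_Icc (fun _ : Fin 3 => -⌈2 ^ n * R + 1⌉) (fun _ => ⌈2 ^ n * R + 1⌉)).subset ?_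
  rintro c ⟨x, hx, hxA⟩
  have key (i : Fin 3) : |(c i : ℝ)| ≤ ⌈2 ^ n * R + 1⌉ := by
    have h1 : |x i| ≤ R := by
      have := (norm_le_pi_norm x i).trans (by simpa using hR hxA)
      simpa using this
    have h2 : |2 ^ n * x i| ≤ 2 ^ n * R := by
      rw [abs_mul, abs_of_pos (show (0 : ℝ) < 2 ^ n by positivity)]; gcongr
    have h3 := abs_le_one_of_mem_cube hx i
    refine le_trans ?_ (Int.le_ceil _)
    rw [abs_le] at *
    constructor <;> linarith
  constructor <;> intro i
  · have := (abs_le.1 (key i)).1; exact_mod_cast this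
  · have := (abs_le.1 (key i)).2; exact_mod_cast this

/-- The union of the cubes of the cells of a chain. -/
def carrier (n : ℕ) (z : Chain) : Set (Fin 3 → ℝ) := ⋃ c : {c // z c ≠ 0}, cube n c

lemma isClosed_carrier (n : ℕ) (z : Chain) : IsClosed (carrier n z) := by
  refine LocallyFinite.isClosed_iUnion (fun x => ⟨Metric.ball x 1, Metric.ball_mem_nhds x one_pos, ?_⟩)
    fun c => isClosed_cube n c
  exact Set.Finite.preimage (s := {c | (cube n c ∩ Metric.ball x 1).Nonempty})
    Subtype.val_injective.injOn (finite_cube_inter n Metric.isBounded_ball)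

lemma cube_subset_carrier {n : ℕ} {z : Chain} {c : Cell} (hc : z c ≠ 0) :
    cube n c ⊆ carrier n z := Set.subset_iUnion (fun c : {c // z c ≠ 0} => cube n c) ⟨c, hc⟩

/-- The cubes of the cells of `z` are disjoint from `A`. -/
def Off (n : ℕ) (A : Set (Fin 3 → ℝ)) (z : Chain) : Prop := Disjoint (carrier n z) A

lemma off_iff {n : ℕ} {A : Set (Fin 3 → ℝ)} {z : Chain} :
    Off n A z ↔ ∀ c, z c ≠ 0 → Disjoint (cube n c) A := by
  simp [Off, carrier, Set.disjoint_iUnion_left]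

lemma carrier_sd_subset (n : ℕ) (z : Chain) : carrier (n + 1) (sd z) ⊆ carrier n z := by
  refine Set.iUnion_subset fun ⟨c, hc⟩ => ?_
  rw [sd_apply] at hc
  split_ifs at hc with h
  · exact absurd rfl hc
  · exact (cube_succ_subset n h).trans (cube_subset_carrier hc)

lemma carrier_sdPow_subset {n m : ℕ} (h : n ≤ m) (z : Chain) :
    carrier m (sdPow n m h z) ⊆ carrier n z := by
  induction m, h using Nat.le_induction with
  | base => simp [sdPow]
  | succ m h ih =>
    have : sdPow n (m + 1) (h.trans (Nat.le_succ m)) z = sd (sdPow n m h z) := by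
      simp only [sdPow]; rw [Nat.succ_sub h, pow_succ']; rfl
    rw [this]
    exact (carrier_sd_subset m _).trans ih

lemma carrier_bdDir_subset (n : ℕ) (i : Fin 3) (z : Chain) :
    carrier n (bdDir i z) ⊆ carrier n z := by
  refine Set.iUnion_subset fun ⟨c, hc⟩ => ?_
  rw [bdDir_apply] at hc
  split_ifs at hc with h
  · by_cases h1 : z (Function.update c i (c i + 1)) = 0
    · rw [h1, zero_add] at hc
      exact (cube_update_subset n h (Or.inr rfl)).trans (cube_subset_carrier hc)
    · exact (cube_update_subset n h (Or.inl rfl)).trans (cube_subset_carrier h1)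
  · exact absurd rfl hc

lemma carrier_add_subset (n : ℕ) (z w : Chain) :
    carrier n (z + w) ⊆ carrier n z ∪ carrier n w := by
  refine Set.iUnion_subset fun ⟨c, hc⟩ => ?_
  by_cases h1 : z c = 0
  · rw [Pi.add_apply, h1, zero_add] at hc
    exact (cube_subset_carrier hc).trans Set.subset_union_right
  · exact (cube_subset_carrier h1).trans Set.subset_union_left

lemma carrier_bdC_subset (n : ℕ) (z : Chain) : carrier n (bdC z) ⊆ carrier n z :=
  (carrier_add_subset n _ _).trans (Set.union_subset ((carrier_add_subset n _ _).trans
    (Set.union_subset (carrier_bdDir_subset n 0 z) (carrier_bdDir_subset n 1 z)))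
    (carrier_bdDir_subset n 2 z))

lemma carrier_mono {n : ℕ} {z w : Chain} (h : ∀ c, z c ≠ 0 → w c ≠ 0) :
    carrier n z ⊆ carrier n w :=
  Set.iUnion_subset fun ⟨c, hc⟩ => cube_subset_carrier (h c hc)

/-- The dyadic chains in the complement of `A`. -/
def offC (A : Set (Fin 3 → ℝ)) : Submodule (ZMod 2) DyadicChain where
  carrier := {z | ∃ n x, lev n x = z ∧ Off n A x}
  zero_mem' := ⟨0, 0, map_zero _, by simp [off_iff]⟩
  add_mem' := by
    rintro _ _ ⟨n, x, rfl, hx⟩ ⟨m, y, rfl, hy⟩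
    refine ⟨max n m, sdPow n _ (le_max_left n m) x + sdPow m _ (le_max_right n m) y,
      by rw [map_add, lev_sdPow, lev_sdPow], ?_⟩
    exact Disjoint.mono_left (carrier_add_subset _ _ _) (Set.disjoint_union_left.2
      ⟨hx.mono_left (carrier_sdPow_subset _ x), hy.mono_left (carrier_sdPow_subset _ y)⟩)
  smul_mem' := by
    rintro a _ ⟨n, x, rfl, hx⟩
    refine ⟨n, a • x, map_smul _ _ _, hx.mono_left (carrier_mono fun c hc h => hc ?_)⟩
    simp [h]

lemma lev_mem_offC {n : ℕ} {A : Set (Fin 3 → ℝ)} {x : Chain} (h : Off n A x) :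
    lev n x ∈ offC A := ⟨n, x, rfl, h⟩

lemma exists_off_ge {A : Set (Fin 3 → ℝ)} {z : DyadicChain} (hz : z ∈ offC A) (N : ℕ) :
    ∃ n x, N ≤ n ∧ lev n x = z ∧ Off n A x := by
  obtain ⟨n, x, rfl, hx⟩ := hz
  exact ⟨max N n, sdPow n _ (le_max_right N n) x, le_max_left N n, lev_sdPow _ _,
    hx.mono_left (carrier_sdPow_subset _ x)⟩

lemma offC_anti {A B : Set (Fin 3 → ℝ)} (h : A ⊆ B) : offC B ≤ offC A := by
  rintro _ ⟨n, x, rfl, hx⟩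
  exact lev_mem_offC (hx.mono_right h)

lemma bd_mem_offC {A : Set (Fin 3 → ℝ)} {z : DyadicChain} (hz : z ∈ offC A) : bd z ∈ offC A := by
  obtain ⟨n, x, rfl, hx⟩ := hz
  rw [bd_lev]
  exact lev_mem_offC (hx.mono_left (carrier_bdC_subset n x))

lemma proj_mem_offC {A : Set (Fin 3 → ℝ)} (k : ℕ) {z : DyadicChain} (hz : z ∈ offC A) :
    proj k z ∈ offC A := by
  obtain ⟨n, x, rfl, hx⟩ := hz
  rw [proj_lev]
  refine lev_mem_offC (hx.mono_left (carrier_mono fun c hc h => hc ?_))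
  simp [projC_apply, h]

lemma mem_offC_union {A B : Set (Fin 3 → ℝ)} {z : DyadicChain} (hA : z ∈ offC A) (hB : z ∈ offC B) :
    z ∈ offC (A ∪ B) := by
  obtain ⟨n, x, rfl, hx⟩ := hA
  obtain ⟨m, y, hnm, hy, hyB⟩ := exists_off_ge hB n
  rw [← lev_sdPow hnm] at hy
  obtain rfl := lev_injective m hy
  rw [← lev_sdPow hnm]
  exact lev_mem_offC (Set.disjoint_union_right.2
    ⟨hx.mono_left (carrier_sdPow_subset _ x), hyB⟩)

lemma mem_offC_empty (z : DyadicChain) : z ∈ offC ∅ := by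
  obtain ⟨n, x, rfl⟩ := exists_lev z
  exact lev_mem_offC (Set.disjoint_empty _)

lemma exists_isOpen_mem_offC {A : Set (Fin 3 → ℝ)} {z : DyadicChain} (hz : z ∈ offC A) :
    ∃ O, IsOpen O ∧ A ⊆ O ∧ z ∈ offC O := by
  obtain ⟨n, x, rfl, hx⟩ := hz
  exact ⟨(carrier n x)ᶜ, (isClosed_carrier n x).isOpen_compl, hx.subset_compl_left,
    lev_mem_offC disjoint_compl_right⟩

/-- Chains off `A ∩ B` split into a finite chain off `A` and a chain off `B`. -/
lemma exists_split {A B : Set (Fin 3 → ℝ)} (hA : IsCompact A) (hB : IsCompact B) {z : DyadicChain}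
    (hz : z ∈ offC (A ∩ B)) : ∃ n x, x.support.Finite ∧ Off n A x ∧
      ∃ b ∈ offC B, lev n x + b = z := by
  obtain ⟨n, x, rfl, hx⟩ := hz
  have hd : Disjoint (A ∩ carrier n x) (B ∩ carrier n x) := by
    rw [Set.disjoint_left]
    rintro p ⟨hpA, hp⟩ ⟨hpB, -⟩
    exact Set.disjoint_left.1 hx hp ⟨hpA, hpB⟩
  obtain ⟨ε, hε, hdist⟩ := Metric.exists_pos_forall_lt_edist
    (hA.inter_right (isClosed_carrier n x)) (hB.inter_right (isClosed_carrier n x)).isClosed hd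
  obtain ⟨k, hk⟩ := exists_pow_lt_of_lt_one (show (0 : ℝ) < ε / 2 by
    have : (0 : ℝ) < ε := hε
    linarith) (show (1 / 2 : ℝ) < 1 by norm_num)
  set m := max n k
  have hm : (2 : ℝ) / 2 ^ m < ε := by
    have : (1 / 2 : ℝ) ^ m ≤ (1 / 2) ^ k :=
      pow_le_pow_of_le_one (by norm_num) (by norm_num) (le_max_right n k)
    rw [one_div_pow] at this
    rw [div_eq_mul_one_div]
    linarith
  set y := sdPow n m (le_max_left n k) x
  classical
  let a : Chain := fun c => if (cube m c ∩ B).Nonempty then y c else 0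
  let b : Chain := fun c => if (cube m c ∩ B).Nonempty then 0 else y c
  have hab : a + b = y := by
    funext c; simp only [a, b, Pi.add_apply]; split_ifs <;> simp
  refine ⟨m, a, (finite_cube_inter m hB.isBounded).subset fun c hc => ?_, ?_, lev m b, ?_, ?_⟩
  · by_contra h
    exact hc (if_neg h)
  · rw [off_iff]
    intro c hc
    have hcB : (cube m c ∩ B).Nonempty := by
      by_contra h
      exact hc (if_neg h)
    have hyc : y c ≠ 0 := by simpa [a, hcB] using hc
    rw [Set.disjoint_left]
    intro p hp hpA
    obtain ⟨q, hq, hqB⟩ := hcB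
    have hsub := (cube_subset_carrier hyc).trans (carrier_sdPow_subset (le_max_left n k) x)
    have h1 := hdist p ⟨hpA, hsub hp⟩ q ⟨hqB, hsub hq⟩
    have h2 := (dist_le_of_mem_cube hp hq).trans_lt hm
    rw [edist_nndist, ENNReal.coe_lt_coe] at h1
    exact lt_asymm h1 h2
  · refine lev_mem_offC (off_iff.2 fun c hc => ?_)
    rw [Set.disjoint_iff_inter_eq_empty, ← Set.not_nonempty_iff_eq_empty]
    intro h
    exact hc (if_pos h)
  · rw [← map_add, hab, lev_sdPow]

/-- The coordinates of the cells of the grid of level `n` that meet an interval. -/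
def touching (n : ℕ) (a b : ℝ) : Set ℤ :=
  {m | ∃ x ∈ Icc a b, |2 ^ n * x - m| ≤ if Odd m then 1 else 0}

lemma gridInterval_touching (n : ℕ) {a b : ℝ} (h : a ≤ b) :
    GridInterval (touching n a b) (2 * ⌊2 ^ n * a / 2⌋ + 1) where
  ordConnected := by
    refine ordConnected_of_Ioo ?_
    rintro b₁ ⟨x, hx, hx'⟩ b₂ ⟨y, hy, hy'⟩ - m ⟨h1, h2⟩
    have hpow : (0 : ℝ) < 2 ^ n := by positivity
    have hx1 := abs_le.1 (hx'.trans (show _ ≤ (1 : ℝ) by split_ifs <;> norm_num))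
    have hy1 := abs_le.1 (hy'.trans (show _ ≤ (1 : ℝ) by split_ifs <;> norm_num))
    have h1' : (b₁ : ℝ) + 1 ≤ m := by exact_mod_cast h1
    have h2' : (m : ℝ) + 1 ≤ b₂ := by exact_mod_cast h2
    refine ⟨m / 2 ^ n, ⟨hx.1.trans ?_, le_trans ?_ hy.2⟩, ?_⟩
    · rw [le_div_iff₀ hpow]; linarith
    · rw [div_le_iff₀ hpow]; linarith
    · rw [mul_div_cancel₀ _ hpow.ne', sub_self, abs_zero]; split_ifs <;> norm_num
  mem := by
    refine ⟨a, ⟨le_rfl, h⟩, ?_⟩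
    rw [if_pos ⟨_, rfl⟩, abs_le]
    have h1 := Int.floor_le (2 ^ n * a / 2)
    have h2 := Int.lt_floor_add_one (2 ^ n * a / 2)
    push_cast
    constructor <;> linarith
  odd := ⟨_, rfl⟩
  add_mem := by
    rintro m ⟨x, hx, hx'⟩ hm
    rw [if_neg (Int.not_odd_iff_even.2 hm), abs_nonpos_iff] at hx'
    refine ⟨x, hx, ?_⟩
    rw [if_pos hm.add_one]
    push_cast
    rw [abs_le]
    constructor <;> linarith
  sub_mem := by
    rintro m ⟨x, hx, hx'⟩ hm
    rw [if_neg (Int.not_odd_iff_even.2 hm), abs_nonpos_iff] at hx'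
    refine ⟨x, hx, ?_⟩
    rw [if_pos (hm.sub_odd odd_one)]
    push_cast
    rw [abs_le]
    constructor <;> linarith

lemma cube_inter_Icc_nonempty {n : ℕ} {c : Cell} {l u : Fin 3 → ℝ} :
    (cube n c ∩ Icc l u).Nonempty ↔ ∀ i, c i ∈ touching n (l i) (u i) := by
  constructor
  · rintro ⟨x, hx, hl, hu⟩ i
    exact ⟨x i, ⟨hl i, hu i⟩, hx i⟩
  · intro h
    choose x hx hx' using h
    exact ⟨x, hx', fun i => (hx i).1, fun i => (hx i).2⟩

lemma off_Icc_iff {n : ℕ} {l u : Fin 3 → ℝ} {x : Chain} :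
    Off n (Icc l u) x ↔ ∀ c : Cell, (∀ i, c i ∈ touching n (l i) (u i)) → x c = 0 := by
  rw [off_iff]
  refine forall_congr' fun c => ?_
  rw [← cube_inter_Icc_nonempty, Set.disjoint_iff_inter_eq_empty, ← Set.not_nonempty_iff_eq_empty]
  tauto

/-- The fundamental class: the sum of all three-dimensional cells. -/
def omega : DyadicChain := lev 0 omegaC

lemma lev_omegaC (n : ℕ) : lev n omegaC = omega := by
  induction n with
  | zero => rfl
  | succ n ih => rw [← ih, ← lev_sd n, sd_omegaC]

lemma bd_omega : bd omega = 0 := by rw [omega, bd_lev, bdC_omegaC, map_zero]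

lemma proj_omega : proj 3 omega = omega := by rw [omega, proj_lev, projC_omegaC]

lemma omegaC_odd {c : Cell} (h : ∀ i, Odd (c i)) : omegaC c = 1 := if_pos h

lemma bd_ne_omega (w : DyadicChain) : bd w ≠ omega := by
  obtain ⟨n, x, rfl⟩ := exists_lev w
  rw [bd_lev, ← lev_omegaC n]
  intro h
  have h1 := congrFun (lev_injective n h) (fun _ => 1)
  rw [bdC_eq_zero_of_odd x (fun _ => odd_one), omegaC_odd fun _ => odd_one] at h1
  exact zero_ne_one h1

lemma exists_eq_bd_add_omega {z : DyadicChain} (hz : bd z = 0) :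
    ∃ (w : DyadicChain) (a : ZMod 2), z = bd w + a • omega := by
  obtain ⟨n, x, rfl⟩ := exists_lev z
  rw [bd_lev] at hz
  have hx := lev_injective n (hz.trans (map_zero _).symm)
  obtain ⟨w, a, h⟩ := exists_eq_bdC_add_omegaC (I := fun _ => univ) (t := fun _ => 1) (z := x)
    (fun _ => gridInterval_univ) fun c _ => congrFun hx c
  refine ⟨lev n w, a, ?_⟩
  rw [bd_lev, ← lev_omegaC n, ← map_smul, ← map_add]
  congr 1
  funext c
  exact h c fun _ => trivial

/-- The chain `z` bounds in the complement of `A`. -/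
def IsBd (A : Set (Fin 3 → ℝ)) (z : DyadicChain) : Prop := ∃ w ∈ offC A, bd w = z

/-- Vanishing of the homology of degree `k` (with arbitrary closed supports) of the complement
of `A`. -/
def Htriv (k : ℕ) (A : Set (Fin 3 → ℝ)) : Prop :=
  ∀ z ∈ offC A, proj k z = z → bd z = 0 → IsBd A z

lemma isBd_Icc {l u : Fin 3 → ℝ} (h : l ≤ u) {z : DyadicChain} (hz : z ∈ offC (Icc l u))
    (hbd : bd z = 0) : IsBd (Icc l u) z := by
  obtain ⟨n, x, rfl, hx⟩ := hz
  rw [bd_lev] at hbd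
  have hx0 := lev_injective n (hbd.trans (map_zero _).symm)
  rw [off_Icc_iff] at hx
  have hI := fun i => gridInterval_touching n (h i)
  obtain ⟨w, a, hw⟩ := exists_eq_bdC_add_omegaC (I := fun _ => univ) (t := fun _ => 1) (z := x)
    (fun _ => gridInterval_univ) fun c _ => congrFun hx0 c
  have ha : a = 0 := by
    have h1 := hw (fun i => 2 * ⌊2 ^ n * l i / 2⌋ + 1) fun _ => trivial
    rw [hx _ fun i => (hI i).mem, bdC_eq_zero_of_odd w fun i => (hI i).odd,
      omegaC_odd fun i => (hI i).odd] at h1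
    simpa using h1.symm
  subst ha
  have hw' : bdC w = x := by funext c; simpa using (hw c fun _ => trivial).symm
  obtain ⟨v, b, hv⟩ := exists_eq_bdC_add_omegaC hI (z := w) fun c hc => by rw [hw', hx c hc]
  refine ⟨lev n (w + (bdC v + b • omegaC)), lev_mem_offC (off_Icc_iff.2 fun c hc => ?_), ?_⟩
  · have := hv c hc
    simp only [Pi.add_apply, Pi.smul_apply, smul_eq_mul, this]
    exact CharTwo.add_self_eq_zero _
  · rw [bd_lev, map_add bdC, map_add bdC, map_smul, bdC_bdC, bdC_omegaC, hw', smul_zero,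
      add_zero, add_zero]

/-- Vanishing of the homology of the complement of `A` in all degrees. -/
def Acyclic (A : Set (Fin 3 → ℝ)) : Prop := ∀ k, Htriv k A

lemma acyclic_singleton (p : Fin 3 → ℝ) : Acyclic {p} := by
  intro k z hz _ hbd
  rw [← Icc_self] at *
  exact isBd_Icc le_rfl hz hbd

lemma proj_proj_of_ne {k l : ℕ} (h : k ≠ l) (z : DyadicChain) : proj k (proj l z) = 0 := by
  obtain ⟨n, x, rfl⟩ := exists_lev z
  rw [proj_lev, proj_lev]
  convert map_zero (lev n)
  funext c
  simp only [projC_apply, Pi.zero_apply]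
  split_ifs <;> first | rfl | omega

lemma htriv_empty {k : ℕ} (hk : k ≠ 3) : Htriv k ∅ := by
  intro z _ hzk hbd
  obtain ⟨w, a, rfl⟩ := exists_eq_bd_add_omega hbd
  refine ⟨proj (k + 1) w, mem_offC_empty _, ?_⟩
  rw [map_add, map_smul, ← proj_omega, proj_proj_of_ne hk, smul_zero, add_zero] at hzk
  rw [bd_proj, hzk, proj_omega]

section

variable {A B : Set (Fin 3 → ℝ)} {z w : DyadicChain} {k : ℕ}

lemma IsBd.bd_eq_zero (h : IsBd A z) : bd z = 0 := by
  obtain ⟨w, -, rfl⟩ := h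
  exact bd_bd w

lemma IsBd.mem_offC (h : IsBd A z) : z ∈ offC A := by
  obtain ⟨w, hw, rfl⟩ := h
  exact bd_mem_offC hw

lemma IsBd.anti (h : IsBd B z) (hAB : A ⊆ B) : IsBd A z := by
  obtain ⟨w, hw, rfl⟩ := h
  exact ⟨w, offC_anti hAB hw, rfl⟩

lemma IsBd.add (h : IsBd A z) (h' : IsBd A w) : IsBd A (z + w) := by
  obtain ⟨x, hx, rfl⟩ := h
  obtain ⟨y, hy, rfl⟩ := h'
  exact ⟨x + y, add_mem hx hy, map_add _ _ _⟩

lemma IsBd.exists_proj (h : IsBd A z) (hz : proj k z = z) :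
    ∃ w ∈ offC A, proj (k + 1) w = w ∧ bd w = z := by
  obtain ⟨w, hw, rfl⟩ := h
  exact ⟨proj (k + 1) w, proj_mem_offC _ hw, proj_proj _ _, by rw [bd_proj, hz]⟩

lemma isBd_zero : IsBd A 0 := ⟨0, zero_mem _, map_zero _⟩

lemma exists_split_proj (hA : IsCompact A) (hB : IsCompact B) (hz : z ∈ offC (A ∩ B))
    (hk : proj k z = z) :
    ∃ a ∈ offC A, ∃ b ∈ offC B, proj k a = a ∧ proj k b = b ∧ a + b = z := by
  obtain ⟨n, x, -, hx, b, hb, hz⟩ := exists_split hA hB hz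
  exact ⟨proj k (lev n x), proj_mem_offC _ (lev_mem_offC hx), proj k b, proj_mem_offC _ hb,
    proj_proj _ _, proj_proj _ _, by rw [← map_add, hz, hk]⟩

lemma exists_common_filling (hA : IsCompact A) (hB : IsCompact B) {a b : DyadicChain}
    (ha : a ∈ offC A) (hb : b ∈ offC B) (h : IsBd (A ∩ B) (a + b)) :
    ∃ w ∈ offC (A ∪ B), bd w = bd a := by
  obtain ⟨q, hq, hqab⟩ := h
  obtain ⟨n, x, -, hx, y, hy, rfl⟩ := exists_split hA hB hq
  have hx := lev_mem_offC hx
  generalize lev n x = x at *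
  refine ⟨a + bd x, mem_offC_union (add_mem ha (bd_mem_offC hx)) ?_,
    by rw [map_add, bd_bd, add_zero]⟩
  have : a + bd x = b + bd y := by
    rw [map_add] at hqab
    rw [← sub_eq_zero, ZModModule.sub_eq_add,
      show a + bd x + (b + bd y) = (bd x + bd y) + (a + b) by abel, hqab, ZModModule.add_self]
  rw [this]
  exact add_mem hb (bd_mem_offC hy)

/-- Mayer-Vietoris: a cycle bounding off `A` and off `B` bounds off `A ∪ B`. -/
lemma IsBd.glue (hA : IsCompact A) (hB : IsCompact B) (hzA : IsBd A z) (hzB : IsBd B z)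
    (hk : proj k z = z) (h : Htriv (k + 1) (A ∩ B)) : IsBd (A ∪ B) z := by
  obtain ⟨a, ha, hak, haz⟩ := hzA.exists_proj hk
  obtain ⟨b, hb, hbk, hbz⟩ := hzB.exists_proj hk
  obtain ⟨w, hw, hwa⟩ := exists_common_filling hA hB ha hb
    (h _ (add_mem (offC_anti inter_subset_left ha) (offC_anti inter_subset_right hb))
      (by rw [map_add, hak, hbk]) (by rw [map_add, haz, hbz, ZModModule.add_self]))
  exact ⟨w, hw, hwa.trans haz⟩

lemma Htriv.union (hA : IsCompact A) (hB : IsCompact B) (hkA : Htriv k A) (hkB : Htriv k B)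
    (h : Htriv (k + 1) (A ∩ B)) : Htriv k (A ∪ B) := fun z hz hk hbd =>
  (hkA z (offC_anti subset_union_left hz) hk hbd).glue hA hB
    (hkB z (offC_anti subset_union_right hz) hk hbd) hk h

lemma Acyclic.union (hA : IsCompact A) (hB : IsCompact B) (hkA : Acyclic A) (hkB : Acyclic B)
    (h : Acyclic (A ∩ B)) : Acyclic (A ∪ B) := fun k => (hkA k).union hA hB (hkB k) (h _)

/-- `g` generates a homology group of degree `k` isomorphic to `ZMod 2` of the complement
of `A`. -/
structure Gen (k : ℕ) (A : Set (Fin 3 → ℝ)) (g : DyadicChain) : Prop where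
  mem : g ∈ offC A
  bd_eq : bd g = 0
  proj_eq : proj k g = g
  not_isBd : ¬ IsBd A g
  span : ∀ z ∈ offC A, proj k z = z → bd z = 0 → IsBd A z ∨ IsBd A (z + g)

lemma gen_empty : Gen 3 ∅ omega where
  mem := mem_offC_empty _
  bd_eq := bd_omega
  proj_eq := proj_omega
  not_isBd := fun ⟨w, _, hw⟩ => bd_ne_omega w hw
  span := by
    intro z _ _ hz
    obtain ⟨w, a, rfl⟩ := exists_eq_bd_add_omega hz
    obtain rfl | rfl := show a = 0 ∨ a = 1 from (by decide : ∀ a : ZMod 2, a = 0 ∨ a = 1) a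
    · left; exact ⟨w, mem_offC_empty _, by simp⟩
    · right
      refine ⟨w, mem_offC_empty _, ?_⟩
      rw [one_smul, add_assoc, ZModModule.add_self, add_zero]

lemma Gen.suspend (hA : IsCompact A) (hB : IsCompact B) (hA' : Acyclic A) (hB' : Acyclic B)
    {a b : DyadicChain} (ha : a ∈ offC A) (hb : b ∈ offC B) (hak : proj (k + 1) a = a)
    (hbk : proj (k + 1) b = b) (h : Gen (k + 1) (A ∩ B) (a + b)) : Gen k (A ∪ B) (bd a) := by
  have hab : bd a = bd b := by
    rw [← sub_eq_zero, ZModModule.sub_eq_add, ← map_add, h.bd_eq]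
  refine ⟨mem_offC_union (bd_mem_offC ha) (hab ▸ bd_mem_offC hb), bd_bd a, by rw [← bd_proj, hak],
    fun hbd => ?_, fun z hz hzk hbz => ?_⟩
  · obtain ⟨w, hw, hwk, hwa⟩ := hbd.exists_proj (by rw [← bd_proj, hak])
    have h1 := hA' (k + 1) (a + w) (add_mem ha (offC_anti subset_union_left hw))
      (by rw [map_add, hak, hwk]) (by rw [map_add, hwa, ZModModule.add_self])
    have h2 := hB' (k + 1) (b + w) (add_mem hb (offC_anti subset_union_right hw))
      (by rw [map_add, hbk, hwk]) (by rw [map_add, hwa, hab, ZModModule.add_self])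
    refine h.not_isBd ?_
    have := (h1.anti (inter_subset_left (t := B))).add (h2.anti inter_subset_right)
    rwa [add_add_add_comm, ZModModule.add_self, add_zero] at this
  · obtain ⟨p, hp, hpk, hpz⟩ :=
      (hA' k z (offC_anti subset_union_left hz) hzk hbz).exists_proj hzk
    obtain ⟨q, hq, hqk, hqz⟩ :=
      (hB' k z (offC_anti subset_union_right hz) hzk hbz).exists_proj hzk
    rcases h.span (p + q) (add_mem (offC_anti inter_subset_left hp)
      (offC_anti inter_subset_right hq)) (by rw [map_add, hpk, hqk])
      (by rw [map_add, hpz, hqz, ZModModule.add_self]) with h1 | h1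
    · obtain ⟨w, hw, hwp⟩ := exists_common_filling hA hB hp hq h1
      exact Or.inl ⟨w, hw, hwp.trans hpz⟩
    · rw [add_add_add_comm] at h1
      obtain ⟨w, hw, hwp⟩ := exists_common_filling hA hB (add_mem hp ha) (add_mem hq hb) h1
      exact Or.inr ⟨w, hw, by rw [hwp, map_add, hpz]⟩

lemma exists_gen_of_pair {A' B' : Set (Fin 3 → ℝ)} (hA : IsCompact A) (hB : IsCompact B)
    (hA' : IsCompact A') (hB' : IsCompact B') (acA : Acyclic A) (acB : Acyclic B)
    (acA' : Acyclic A') (acB' : Acyclic B') (hAA : A' ⊆ A) (hBB : B' ⊆ B)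
    (h : ∃ g, Gen (k + 1) (A ∩ B) g ∧ Gen (k + 1) (A' ∩ B') g) :
    ∃ g, Gen k (A ∪ B) g ∧ Gen k (A' ∪ B') g := by
  obtain ⟨g, hg, hg'⟩ := h
  obtain ⟨a, ha, b, hb, hak, hbk, rfl⟩ := exists_split_proj hA hB hg.mem hg.proj_eq
  exact ⟨bd a, hg.suspend hA hB acA acB ha hb hak hbk, hg'.suspend hA' hB' acA' acB'
    (offC_anti hAA ha) (offC_anti hBB hb) hak hbk⟩

lemma Gen.isBd_of_subset {A' : Set (Fin 3 → ℝ)} {g : DyadicChain} (h : Gen k A g)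
    (h' : Gen k A' g) (hz : z ∈ offC A) (hk : proj k z = z) (hbd : bd z = 0) (hAA : A' ⊆ A)
    (hz' : IsBd A' z) : IsBd A z := by
  refine (h.span z hz hk hbd).resolve_right fun h1 => h'.not_isBd ?_
  have := (h1.anti hAA).add hz'
  rwa [add_comm z, add_assoc, ZModModule.add_self, add_zero] at this

/-- A cycle bounding off every fibre of a compact set over an interval bounds off the set. -/
lemma isBd_image_of_fibre {P : Type*} [TopologicalSpace P] {F : P → Fin 3 → ℝ} {S : Set P}
    {π : P → ℝ} {a b : ℝ} (hS : IsCompact S) (hF : ContinuousOn F S) (hinj : InjOn F S)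
    (hπ : ContinuousOn π S) (hab : a ≤ b) (hmaps : MapsTo π S (Icc a b)) (hk : proj k z = z)
    (hz : ∀ t ∈ Icc a b, IsBd (F '' (S ∩ π ⁻¹' {t})) z)
    (htriv : ∀ t ∈ Icc a b, Htriv (k + 1) (F '' (S ∩ π ⁻¹' {t}))) : IsBd (F '' S) z := by
  have hcpt {T : Set ℝ} (hT : IsClosed T) : IsCompact (F '' (S ∩ π ⁻¹' T)) := by
    obtain ⟨C, hC, hCS⟩ := continuousOn_iff_isClosed.1 hπ T hT
    rw [inter_comm, hCS, inter_comm]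
    exact (hS.inter_right hC).image_of_continuousOn (hF.mono inter_subset_left)
  have hloc (t : Icc a b) : ∃ U : Set (Icc a b), IsOpen U ∧ t ∈ U ∧
      ∀ T : Set ℝ, (∀ s (hs : s ∈ Icc a b), s ∈ T → ⟨s, hs⟩ ∈ U) → IsBd (F '' (S ∩ π ⁻¹' T)) z := by
    obtain ⟨w, hw, hwz⟩ := hz t t.2
    obtain ⟨O, hO, hsub, hwO⟩ := exists_isOpen_mem_offC hw
    have hK : IsCompact (π '' (S ∩ F ⁻¹' Oᶜ)) := by
      obtain ⟨C, hC, hCS⟩ := continuousOn_iff_isClosed.1 hF Oᶜ hO.isClosed_compl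
      rw [inter_comm, hCS, inter_comm]
      exact (hS.inter_right hC).image_of_continuousOn (hπ.mono inter_subset_left)
    refine ⟨Subtype.val ⁻¹' (π '' (S ∩ F ⁻¹' Oᶜ))ᶜ,
      hK.isClosed.isOpen_compl.preimage continuous_subtype_val, ?_, fun T hT => ?_⟩
    · rintro ⟨p, ⟨hpS, hpO⟩, hpt⟩
      exact hpO (hsub ⟨p, ⟨hpS, hpt⟩, rfl⟩)
    · refine ⟨w, offC_anti ?_ hwO, hwz⟩
      rintro _ ⟨p, ⟨hpS, hpT⟩, rfl⟩
      by_contra hpO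
      exact hT (π p) (hmaps hpS) hpT ⟨p, ⟨hpS, hpO⟩, rfl⟩
  choose U hU htU hUbd using hloc
  obtain ⟨t, ht0, hmono, ⟨N, hN⟩, hcover⟩ := exists_monotone_Icc_subset_open_cover_Icc hab hU
    (fun t _ => mem_iUnion.2 ⟨t, htU t⟩)
  have key (n : ℕ) : IsBd (F '' (S ∩ π ⁻¹' (Icc a (t n)))) z := by
    induction n with
    | zero =>
      rw [ht0, Icc_self]
      exact hz a ⟨le_rfl, hab⟩
    | succ n ih =>
      obtain ⟨i, hi⟩ := hcover n
      have h1 := hUbd i (Icc (t n : ℝ) (t (n + 1))) fun s hs hsT => hi ⟨hsT.1, hsT.2⟩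
      have hle : (t n : ℝ) ≤ t (n + 1) := hmono (Nat.le_succ n)
      have := ih.glue (hcpt isClosed_Icc) (hcpt isClosed_Icc) h1 hk (by
        rw [← hinj.image_inter inter_subset_left inter_subset_left, ← inter_inter_distrib_left,
          ← preimage_inter, Icc_inter_Icc_eq_singleton (t n).2.1 hle]
        exact htriv _ (t n).2)
      rwa [← image_union, ← inter_union_distrib_left, ← preimage_union,
        Icc_union_Icc_eq_Icc (t n).2.1 hle] at this
  have := key N
  rw [hN N le_rfl] at this
  rwa [show S ∩ π ⁻¹' Icc a b = S from inter_eq_left.2 hmaps] at this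

lemma acyclic_image_of_fibre {P : Type*} [TopologicalSpace P] {F : P → Fin 3 → ℝ} {S : Set P}
    {π : P → ℝ} {a b : ℝ} (hS : IsCompact S) (hF : ContinuousOn F S) (hinj : InjOn F S)
    (hπ : ContinuousOn π S) (hab : a ≤ b) (hmaps : MapsTo π S (Icc a b))
    (h : ∀ t ∈ Icc a b, Acyclic (F '' (S ∩ π ⁻¹' {t}))) : Acyclic (F '' S) :=
  fun k _ hz hk hbd => isBd_image_of_fibre hS hF hinj hπ hab hmaps hk
    (fun t ht => h t ht k _ (offC_anti (image_mono inter_subset_left) hz) hk hbd)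
    fun t ht => h t ht (k + 1)

end

/-- The closed arc of the circle between two angles. -/
def arc (a b : ℝ) : Set Circle := Circle.exp '' Icc a b

lemma isClosed_arc (a b : ℝ) : IsClosed (arc a b) :=
  (isCompact_Icc.image Circle.exp.continuous).isClosed

lemma mem_arc_iff {a b t : ℝ} (h0 : a ≤ t) (h1 : t < a + 2 * Real.pi)
    (hb : b < a + 2 * Real.pi) : Circle.exp t ∈ arc a b ↔ t ≤ b := by
  constructor
  · rintro ⟨s, hs, hst⟩
    have := Circle.exp_injOn_Ico (show a + 2 * Real.pi - a ≤ 2 * Real.pi by linarith)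
      ⟨hs.1, hs.2.trans_lt hb⟩ ⟨h0, h1⟩ hst
    exact this ▸ hs.2
  · exact fun h => ⟨t, ⟨h0, h⟩, rfl⟩

lemma exists_exp_eq (a : ℝ) (θ : Circle) :
    ∃ t, a ≤ t ∧ t < a + 2 * Real.pi ∧ Circle.exp t = θ := by
  obtain ⟨s, rfl⟩ := Circle.exp_surjective θ
  obtain ⟨t, ht, hts⟩ := Circle.periodic_exp.exists_mem_Ico (show 0 < 2 * Real.pi by positivity) s a
  exact ⟨t, ht.1, ht.2, hts.symm⟩

lemma arc_self (a : ℝ) : arc a a = {Circle.exp a} := by simp [arc]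

lemma arc_union_and_inter_complement {a b : ℝ} (h : b < a + 2 * Real.pi) (hab : a ≤ b) :
    arc a b ∪ arc b (a + 2 * Real.pi) = univ ∧
      arc a b ∩ arc b (a + 2 * Real.pi) = arc a a ∪ arc b b := by
  constructor
  · refine eq_univ_of_forall fun θ => ?_
    obtain ⟨t, h0, h1, rfl⟩ := exists_exp_eq a θ
    rcases le_total t b with h2 | h2
    · exact Or.inl ⟨t, ⟨h0, h2⟩, rfl⟩
    · exact Or.inr ⟨t, ⟨h2, h1.le⟩, rfl⟩
  · rw [arc_self, arc_self]
    apply Subset.antisymm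
    · rintro _ ⟨⟨t, ht, rfl⟩, s, hs, hst⟩
      rcases hs.2.lt_or_eq with h2 | h2
      · have := Circle.exp_injOn_Ico (show a + 2 * Real.pi - a ≤ 2 * Real.pi by linarith)
          ⟨hab.trans hs.1, h2⟩ ⟨ht.1, ht.2.trans_lt h⟩ hst
        subst this
        rw [le_antisymm ht.2 hs.1]
        exact Or.inr rfl
      · rw [h2, Circle.exp_add_two_pi] at hst
        exact Or.inl hst.symm
    · rintro _ (rfl | rfl)
      · exact ⟨⟨a, ⟨le_rfl, hab⟩, rfl⟩, a + 2 * Real.pi, ⟨h.le, le_rfl⟩, Circle.exp_add_two_pi a⟩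
      · exact ⟨⟨b, ⟨hab, le_rfl⟩, rfl⟩, b, ⟨le_rfl, h.le⟩, rfl⟩

lemma two_arcs : arc 0 Real.pi ∪ arc Real.pi (2 * Real.pi) = univ ∧
    arc 0 Real.pi ∩ arc Real.pi (2 * Real.pi) = arc 0 0 ∪ arc Real.pi Real.pi := by
  have := arc_union_and_inter_complement (a := 0) (b := Real.pi) (by linarith [Real.pi_pos])
    Real.pi_pos.le
  simpa using this

lemma antipodes : arc 0 0 ∩ arc Real.pi Real.pi = ∅ := by
  rw [arc_self, arc_self, Circle.exp_zero, singleton_inter_eq_empty, mem_singleton_iff]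
  exact Circle.exp_pi_ne_one.symm

section

variable {Γ : Type*} {F : Γ × Circle → Fin 3 → ℝ} {T T' : Set Γ}

/-- All products of `T` with arcs of the circle have acyclic complement. -/
def AcT (F : Γ × Circle → Fin 3 → ℝ) (T : Set Γ) : Prop :=
  ∀ a b, a ≤ b → b < a + 2 * Real.pi → Acyclic (F '' (T ×ˢ arc a b))

lemma prod_image_inter (hinj : Function.Injective F) (T T' : Set Γ) (I I' : Set Circle) :
    F '' (T ×ˢ I) ∩ F '' (T' ×ˢ I') = F '' ((T ∩ T') ×ˢ (I ∩ I')) := by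
  rw [← image_inter hinj, prod_inter_prod]

lemma image_prod_univ (T : Set Γ) : F '' (T ×ˢ univ) =
    F '' (T ×ˢ arc 0 Real.pi) ∪ F '' (T ×ˢ arc Real.pi (2 * Real.pi)) := by
  rw [← image_union, ← prod_union, two_arcs.1]

lemma image_prod_two_arcs (hinj : Function.Injective F) (T : Set Γ) :
    F '' (T ×ˢ arc 0 Real.pi) ∩ F '' (T ×ˢ arc Real.pi (2 * Real.pi)) =
      F '' (T ×ˢ arc 0 0) ∪ F '' (T ×ˢ arc Real.pi Real.pi) := by
  rw [prod_image_inter hinj, inter_self, two_arcs.2, prod_union, image_union]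

lemma image_prod_antipodes (hinj : Function.Injective F) (T : Set Γ) :
    F '' (T ×ˢ arc 0 0) ∩ F '' (T ×ˢ arc Real.pi Real.pi) = ∅ := by
  rw [prod_image_inter hinj, antipodes, prod_empty, image_empty]

variable [TopologicalSpace Γ]

lemma acT_singleton (hF : Continuous F) (hinj : Function.Injective F) (x : Γ) : AcT F {x} := by
  intro a b hab hlt
  have himg (J : Set ℝ) :
      F '' ({x} ×ˢ (Circle.exp '' J)) = (fun t : ℝ => F (x, Circle.exp t)) '' J := by
    ext p
    simp
  rw [arc, himg]
  refine acyclic_image_of_fibre (π := id) isCompact_Icc (Continuous.continuousOn (by fun_prop))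
    (fun s hs t ht hst => ?_) continuousOn_id hab (mapsTo_id _) fun t ht => ?_
  · exact Circle.exp_injOn_Icc (by linarith) hs ht (Prod.ext_iff.1 (hinj hst)).2
  · have : Icc a b ∩ id ⁻¹' {t} = {t} := by simpa using ht
    rw [this, image_singleton]
    exact acyclic_singleton _

variable [CompactSpace Γ]

lemma isCompact_prod_image (hF : Continuous F) (hT : IsClosed T) {I : Set Circle}
    (hI : IsClosed I) : IsCompact (F '' (T ×ˢ I)) :=
  ((hT.prod hI).isCompact).image hF

lemma AcT.of_fibre (hF : Continuous F) (hinj : Function.Injective F) (hT : IsClosed T)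
    {p : Γ → ℝ} (hp : Continuous p) {s t : ℝ} (hst : s ≤ t) (hmaps : MapsTo p T (Icc s t))
    (h : ∀ r ∈ Icc s t, ∃ x, T ∩ p ⁻¹' {r} = {x}) : AcT F T := by
  intro a b hab hlt
  refine acyclic_image_of_fibre (π := p ∘ Prod.fst) ((hT.prod (isClosed_arc a b)).isCompact)
    hF.continuousOn hinj.injOn (by fun_prop) hst (fun q hq => hmaps hq.1) fun r hr => ?_
  obtain ⟨x, hx⟩ := h r hr
  rw [preimage_comp, ← prod_univ, prod_inter_prod, hx, inter_univ]
  exact acT_singleton hF hinj x a b hab hlt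

lemma AcT.union (hF : Continuous F) (hinj : Function.Injective F) (hT : IsClosed T)
    (hT' : IsClosed T') (h : AcT F T) (h' : AcT F T') (hi : AcT F (T ∩ T')) :
    AcT F (T ∪ T') := by
  intro a b hab hlt
  rw [union_prod, image_union]
  refine (h a b hab hlt).union (isCompact_prod_image hF hT (isClosed_arc a b))
    (isCompact_prod_image hF hT' (isClosed_arc a b)) (h' a b hab hlt) ?_
  rw [prod_image_inter hinj, inter_self]
  exact hi a b hab hlt

lemma AcT.htriv_zero (hF : Continuous F) (hinj : Function.Injective F) (hT : IsClosed T)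
    (h : AcT F T) : Htriv 0 (F '' (T ×ˢ univ)) := by
  have hpi := Real.pi_pos
  rw [image_prod_univ]
  refine Htriv.union (isCompact_prod_image hF hT (isClosed_arc _ _))
    (isCompact_prod_image hF hT (isClosed_arc _ _)) (h _ _ (by linarith) (by linarith) 0)
    (h _ _ (by linarith) (by linarith) 0) ?_
  rw [image_prod_two_arcs hinj]
  refine Htriv.union (isCompact_prod_image hF hT (isClosed_arc _ _))
    (isCompact_prod_image hF hT (isClosed_arc _ _)) (h _ _ le_rfl (by linarith) 1)
    (h _ _ le_rfl (by linarith) 1) ?_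
  rw [image_prod_antipodes hinj]
  exact htriv_empty (by norm_num)

lemma AcT.exists_gen (hF : Continuous F) (hinj : Function.Injective F) (hT : IsClosed T)
    (hT' : IsClosed T') (h : AcT F T) (h' : AcT F T') (hsub : T' ⊆ T) :
    ∃ g, Gen 1 (F '' (T ×ˢ univ)) g ∧ Gen 1 (F '' (T' ×ˢ univ)) g := by
  have hpi := Real.pi_pos
  have hc (a b : ℝ) := isCompact_prod_image hF hT (isClosed_arc a b)
  have hc' (a b : ℝ) := isCompact_prod_image hF hT' (isClosed_arc a b)
  have hs (a b : ℝ) : F '' (T' ×ˢ arc a b) ⊆ F '' (T ×ˢ arc a b) :=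
    image_mono (prod_mono_left hsub)
  rw [image_prod_univ T, image_prod_univ T']
  refine exists_gen_of_pair (hc _ _) (hc _ _) (hc' _ _) (hc' _ _) (h _ _ (by linarith) (by linarith))
    (h _ _ (by linarith) (by linarith)) (h' _ _ (by linarith) (by linarith))
    (h' _ _ (by linarith) (by linarith)) (hs _ _) (hs _ _) ?_
  rw [image_prod_two_arcs hinj, image_prod_two_arcs hinj]
  refine exists_gen_of_pair (hc _ _) (hc _ _) (hc' _ _) (hc' _ _) (h _ _ le_rfl (by linarith))
    (h _ _ le_rfl (by linarith)) (h' _ _ le_rfl (by linarith)) (h' _ _ le_rfl (by linarith))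
    (hs _ _) (hs _ _) ?_
  rw [image_prod_antipodes hinj, image_prod_antipodes hinj]
  exact ⟨omega, gen_empty, gen_empty⟩

lemma AcT.isBd_of_subset (hF : Continuous F) (hinj : Function.Injective F) (hT : IsClosed T)
    (hT' : IsClosed T') (h : AcT F T) (h' : AcT F T') (hsub : T' ⊆ T) {z : DyadicChain}
    (hz : z ∈ offC (F '' (T ×ˢ univ))) (hk : proj 1 z = z) (hbd : bd z = 0)
    (hz' : IsBd (F '' (T' ×ˢ univ)) z) : IsBd (F '' (T ×ˢ univ)) z := by
  obtain ⟨g, hg, hg'⟩ := AcT.exists_gen hF hinj hT hT' h h' hsub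
  exact hg.isBd_of_subset hg' hz hk hbd (image_mono (prod_mono_left hsub)) hz'

lemma htriv_zero_union (hF : Continuous F) (hinj : Function.Injective F) (hT : IsClosed T)
    (hT' : IsClosed T') (h : Htriv 0 (F '' (T ×ˢ univ))) (h' : Htriv 0 (F '' (T' ×ˢ univ)))
    (hd : Disjoint T T') : Htriv 0 (F '' ((T ∪ T') ×ˢ univ)) := by
  rw [union_prod, image_union]
  refine h.union (isCompact_prod_image hF hT isClosed_univ)
    (isCompact_prod_image hF hT' isClosed_univ) h' ?_
  rw [prod_image_inter hinj, hd.inter_eq, empty_prod, image_empty]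
  exact htriv_empty (by norm_num)

/-- The boundary of the product of an arc `T` and an arc of the circle is a circle. -/
lemma exists_gen_boundary (hF : Continuous F) (hinj : Function.Injective F) (hT : IsClosed T)
    (h : AcT F T) {x y : Γ} [T2Space Γ] (hx : x ∈ T) (hy : y ∈ T) (hxy : x ≠ y) {a b : ℝ}
    (hab : a < b) (hlt : b < a + 2 * Real.pi) :
    ∃ g, Gen 1 (F '' ({x, y} ×ˢ arc a b ∪ T ×ˢ (arc a a ∪ arc b b))) g := by
  have hpi := Real.pi_pos
  have hne : Circle.exp a ≠ Circle.exp b := fun heq =>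
    hab.ne (Circle.exp_injOn_Icc (by linarith) ⟨le_rfl, hab.le⟩ ⟨hab.le, le_rfl⟩ heq)
  have hax : Circle.exp a ∈ arc a b := ⟨a, ⟨le_rfl, hab.le⟩, rfl⟩
  have hbx : Circle.exp b ∈ arc a b := ⟨b, ⟨hab.le, le_rfl⟩, rfl⟩
  have hc {T : Set Γ} (hT : IsClosed T) (a b : ℝ) := isCompact_prod_image hF hT (isClosed_arc a b)
  have hs (x : Γ) := isClosed_singleton (x := x)
  have hpt (x : Γ) := acT_singleton hF hinj x
  have hside {x : Γ} {c : ℝ} (hxT : x ∈ T) (hc' : Circle.exp c ∈ arc a b) :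
      Acyclic (F '' ({x} ×ˢ arc a b) ∪ F '' (T ×ˢ arc c c)) := by
    refine (hpt x a b hab.le hlt).union (hc (hs x) _ _) (hc hT _ _) (h c c le_rfl (by linarith)) ?_
    rw [prod_image_inter hinj, inter_eq_left.2 (singleton_subset_iff.2 hxT), arc_self,
      inter_eq_right.2 (singleton_subset_iff.2 hc'), ← arc_self]
    exact hpt x c c le_rfl (by linarith)
  have hcpt (x : Γ) (c : ℝ) : IsCompact (F '' ({x} ×ˢ arc a b) ∪ F '' (T ×ˢ arc c c)) :=
    (hc (hs x) _ _).union (hc hT _ _)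
  have hU : F '' ({x, y} ×ˢ arc a b ∪ T ×ˢ (arc a a ∪ arc b b)) =
      (F '' ({x} ×ˢ arc a b) ∪ F '' (T ×ˢ arc b b)) ∪
        (F '' ({y} ×ˢ arc a b) ∪ F '' (T ×ˢ arc a a)) := by
    rw [insert_eq, union_prod, prod_union, image_union, image_union, image_union]
    ext p
    simp only [mem_union]
    tauto
  have hI : (F '' ({x} ×ˢ arc a b) ∪ F '' (T ×ˢ arc b b)) ∩
        (F '' ({y} ×ˢ arc a b) ∪ F '' (T ×ˢ arc a a)) =
      F '' ({x} ×ˢ arc a a) ∪ F '' ({y} ×ˢ arc b b) := by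
    rw [union_inter_distrib_right, inter_union_distrib_left, inter_union_distrib_left,
      prod_image_inter hinj, prod_image_inter hinj, prod_image_inter hinj, prod_image_inter hinj,
      inter_eq_left.2 (singleton_subset_iff.2 hx), inter_eq_right.2 (singleton_subset_iff.2 hy),
      arc_self, arc_self, inter_eq_right.2 (singleton_subset_iff.2 hax),
      inter_eq_left.2 (singleton_subset_iff.2 hbx),
      singleton_inter_eq_empty.2 (show x ∉ {y} from hxy),
      singleton_inter_eq_empty.2 (show Circle.exp b ∉ {Circle.exp a} from hne.symm)]
    simp
  obtain ⟨g, hg, -⟩ := exists_gen_of_pair (k := 1) (hcpt x b) (hcpt y a) (hcpt x b) (hcpt y a)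
    (hside hx hbx) (hside hy hax) (hside hx hbx) (hside hy hax) Subset.rfl Subset.rfl (by
      rw [hI]
      refine exists_gen_of_pair (hc (hs x) _ _) (hc (hs y) _ _) (hc (hs x) _ _) (hc (hs y) _ _)
        (hpt x _ _ le_rfl (by linarith)) (hpt y _ _ le_rfl (by linarith))
        (hpt x _ _ le_rfl (by linarith)) (hpt y _ _ le_rfl (by linarith)) Subset.rfl Subset.rfl ?_
      rw [prod_image_inter hinj, singleton_inter_eq_empty.2 (show x ∉ {y} from hxy), empty_prod,
        image_empty]
      exact ⟨omega, gen_empty, gen_empty⟩)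
  exact ⟨g, hU ▸ hg⟩

end

/-- The geometric realization of the complete graph on five vertices. -/
abbrev KFive : Type := ↥(graphRealization (⊤ : SimpleGraph (Fin 5)))

/-- The points of `KFive` whose barycentric coordinates are supported in `s`. -/
def face (s : Finset (Fin 5)) : Set KFive := {x | ∀ k ∉ s, x.1 k = 0}

lemma continuous_coord (i : Fin 5) : Continuous fun x : KFive => x.1 i :=
  (continuous_apply i).comp continuous_subtype_val

lemma isClosed_face (s : Finset (Fin 5)) : IsClosed (face s) := by
  have : face s = ⋂ k, ⋂ (_ : k ∉ s), {x : KFive | x.1 k = 0} := by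
    ext x; simp [face]
  rw [this]
  exact isClosed_iInter fun k => isClosed_iInter fun _ =>
    isClosed_eq (continuous_coord k) continuous_const

lemma face_mono {s t : Finset (Fin 5)} (h : s ⊆ t) : face s ⊆ face t :=
  fun _ hx k hk => hx k fun hs => hk (h hs)

lemma face_inter (s t : Finset (Fin 5)) : face s ∩ face t = face (s ∩ t) := by
  ext x
  simp only [face, mem_inter_iff, mem_ofPred_eq, Finset.mem_inter, not_and_or]
  exact ⟨fun h k hk => hk.elim (h.1 k) (h.2 k),
    fun h => ⟨fun k hk => h k (Or.inl hk), fun k hk => h k (Or.inr hk)⟩⟩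

lemma mem_graphRealization_top {x : Fin 5 → ℝ} : x ∈ graphRealization (⊤ : SimpleGraph (Fin 5)) ↔
    ∃ i j, i ≠ j ∧ ∃ a b : ℝ, 0 ≤ a ∧ 0 ≤ b ∧ a + b = 1 ∧ a • vert i + b • vert j = x := by
  simp [graphRealization, segment, mem_iUnion]

lemma exists_face_of_mem (x : KFive) : ∃ i j, i ≠ j ∧ x ∈ face {i, j} := by
  obtain ⟨i, j, hij, a, b, -, -, -, h⟩ := mem_graphRealization_top.1 x.2
  refine ⟨i, j, hij, fun k hk => ?_⟩
  simp only [Finset.mem_insert, Finset.mem_singleton, not_or] at hk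
  rw [← h]
  simp [vert, hk.1, hk.2]

lemma coord_nonneg (x : KFive) (k : Fin 5) : 0 ≤ x.1 k := by
  obtain ⟨i, j, hij, a, b, ha, hb, -, h⟩ := mem_graphRealization_top.1 x.2
  rw [← h]
  simp only [vert, Pi.add_apply, Pi.smul_apply, smul_eq_mul]
  split_ifs <;> simp [ha, hb, add_nonneg]

lemma sum_coord (x : KFive) : ∑ k, x.1 k = 1 := by
  obtain ⟨i, j, hij, a, b, ha, hb, hab, h⟩ := mem_graphRealization_top.1 x.2
  rw [← h]
  simp [vert, Finset.sum_add_distrib, hab]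

lemma coord_le_one (x : KFive) (k : Fin 5) : x.1 k ≤ 1 :=
  (sum_coord x).symm ▸ Finset.single_le_sum (fun i _ => coord_nonneg x i) (Finset.mem_univ k)

lemma sum_coord_of_mem_face {s : Finset (Fin 5)} {x : KFive} (hx : x ∈ face s) :
    ∑ k ∈ s, x.1 k = 1 := by
  rw [← sum_coord x]
  exact Finset.sum_subset (Finset.subset_univ s) fun k _ hk => hx k hk

lemma face_empty : face ∅ = ∅ := by
  refine eq_empty_of_forall_notMem fun x hx => ?_
  simpa using sum_coord_of_mem_face hx

lemma coord_add_of_mem_face {i j : Fin 5} (hij : i ≠ j) {x : KFive} (hx : x ∈ face {i, j}) :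
    x.1 i + x.1 j = 1 := by
  simpa [Finset.sum_pair hij] using sum_coord_of_mem_face hx

lemma exists_fibre_eq {i j : Fin 5} (hij : i ≠ j) {r : ℝ} (hr : r ∈ Icc (0 : ℝ) 1) :
    ∃ x, face {i, j} ∩ (fun x : KFive => x.1 i) ⁻¹' {r} = {x} := by
  refine ⟨⟨r • vert i + (1 - r) • vert j, mem_graphRealization_top.2
    ⟨i, j, hij, r, 1 - r, hr.1, by linarith [hr.2], by ring, rfl⟩⟩, ?_⟩
  ext x
  simp only [mem_inter_iff, mem_preimage, mem_singleton_iff]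
  constructor
  · rintro ⟨hx, hxi⟩
    ext k
    have hs := coord_add_of_mem_face hij hx
    simp only [vert, Pi.add_apply, Pi.smul_apply, smul_eq_mul]
    by_cases hki : k = i
    · subst hki; simp [hij, hxi]
    · by_cases hkj : k = j
      · subst hkj; simp [hij.symm]; linarith
      · simp [hki, hkj, hx k (by simp [hki, hkj])]
  · rintro rfl
    refine ⟨fun k hk => ?_, ?_⟩
    · simp only [Finset.mem_insert, Finset.mem_singleton, not_or] at hk
      simp [vert, hk.1, hk.2]
    · simp [vert, hij]

lemma exists_face_singleton (i : Fin 5) : ∃ x, face {i} = {x} := by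
  obtain ⟨j, hj⟩ := exists_ne i
  obtain ⟨x, hx⟩ := exists_fibre_eq hj.symm (r := 1) (by simp)
  refine ⟨x, hx ▸ Subset.antisymm (fun y hy => ⟨face_mono (by simp) hy, ?_⟩) ?_⟩
  · simpa using sum_coord_of_mem_face hy
  · rintro y ⟨hy, hyi⟩ k hk
    have hs := coord_add_of_mem_face hj.symm hy
    simp only [mem_preimage, mem_singleton_iff] at hyi
    by_cases hkj : k = j
    · subst hkj; linarith
    · exact hy k (by simpa [hkj] using hk)

instance : CompactSpace KFive := by
  rw [← isCompact_iff_compactSpace]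
  refine isCompact_iUnion fun p => ?_
  rw [segment_eq_image]
  exact isCompact_Icc.image (by fun_prop)

section

variable {F : KFive × Circle → Fin 3 → ℝ}

lemma acT_face_singleton (hF : Continuous F) (hinj : Function.Injective F) (i : Fin 5) :
    AcT F (face {i}) := by
  obtain ⟨x, hx⟩ := exists_face_singleton i
  exact hx ▸ acT_singleton hF hinj x

/-- The part of an edge of `KFive` where a coordinate lies in `[s, t]`. -/
def edgePart (i j : Fin 5) (s t : ℝ) : Set KFive := face {i, j} ∩ {x | x.1 i ∈ Icc s t}

lemma isClosed_edgePart (i j : Fin 5) (s t : ℝ) : IsClosed (edgePart i j s t) :=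
  (isClosed_face _).inter (isClosed_Icc.preimage (continuous_coord i))

lemma acT_edgePart (hF : Continuous F) (hinj : Function.Injective F) {i j : Fin 5} (hij : i ≠ j)
    {s t : ℝ} (h0 : 0 ≤ s) (hst : s ≤ t) (h1 : t ≤ 1) : AcT F (edgePart i j s t) := by
  refine AcT.of_fibre hF hinj (isClosed_edgePart i j s t) (continuous_coord i) hst
    (fun x hx => hx.2) fun r hr => ?_
  obtain ⟨x, hx⟩ := exists_fibre_eq hij ⟨h0.trans hr.1, hr.2.trans h1⟩
  refine ⟨x, hx ▸ ?_⟩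
  rw [edgePart, inter_assoc]
  congr 1
  exact inter_eq_right.2 fun y hy => by rw [mem_ofPred_eq, show y.1 i = r from hy]; exact hr

lemma acT_face_pair (hF : Continuous F) (hinj : Function.Injective F) {i j : Fin 5} (hij : i ≠ j) :
    AcT F (face {i, j}) := by
  have := acT_edgePart hF hinj hij le_rfl zero_le_one le_rfl
  rwa [edgePart, inter_eq_left.2 (show face {i, j} ⊆ {x | x.1 i ∈ Icc (0 : ℝ) 1} from
    fun x _ => ⟨coord_nonneg x i, coord_le_one x i⟩)] at this

lemma acT_face_of_card (hF : Continuous F) (hinj : Function.Injective F) {s : Finset (Fin 5)}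
    (hs : s.card = 2) : AcT F (face s) := by
  obtain ⟨i, j, hij, rfl⟩ := Finset.card_eq_two.1 hs
  exact acT_face_pair hF hinj hij

lemma acT_face_union (hF : Continuous F) (hinj : Function.Injective F) {s t : Finset (Fin 5)}
    (hs : s.card = 2) (ht : t.card = 2) (hst : (s ∩ t).card = 1) : AcT F (face s ∪ face t) := by
  refine (acT_face_of_card hF hinj hs).union hF hinj (isClosed_face _) (isClosed_face _)
    (acT_face_of_card hF hinj ht) ?_
  obtain ⟨i, hi⟩ := Finset.card_eq_one.1 hst
  rw [face_inter, hi]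
  exact acT_face_singleton hF hinj i

/-- Two edges together with the vertices in `V`. -/
lemma htriv_zero_two_edges (hF : Continuous F) (hinj : Function.Injective F)
    {s t : Finset (Fin 5)} (hs : s.card = 2) (ht : t.card = 2) (hst : s ≠ t)
    (V : Finset (Fin 5)) :
    Htriv 0 (F '' ((face s ∪ face t ∪ ⋃ i ∈ V, face {i}) ×ˢ univ)) := by
  have hcl (V : Finset (Fin 5)) : IsClosed (face s ∪ face t ∪ ⋃ i ∈ V, face {i}) :=
    ((isClosed_face s).union (isClosed_face t)).union
      (isClosed_biUnion_finset fun i _ => isClosed_face {i})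
  induction V using Finset.induction_on with
  | empty =>
    simp only [Finset.notMem_empty, iUnion_of_empty, iUnion_empty, union_empty]
    rcases Nat.lt_or_ge (s ∩ t).card 1 with h | h
    · refine htriv_zero_union hF hinj (isClosed_face _) (isClosed_face _)
        ((acT_face_of_card hF hinj hs).htriv_zero hF hinj (isClosed_face _))
        ((acT_face_of_card hF hinj ht).htriv_zero hF hinj (isClosed_face _)) ?_
      have h0 : s ∩ t = ∅ := Finset.card_eq_zero.1 (by omega)
      rw [disjoint_iff_inter_eq_empty, face_inter, h0, face_empty]
    · refine (acT_face_union hF hinj hs ht ?_).htriv_zero hF hinj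
        ((isClosed_face _).union (isClosed_face _))
      refine le_antisymm (not_lt.1 fun h2 => hst ?_) h
      have h3 : s ∩ t = s := Finset.eq_of_subset_of_card_le Finset.inter_subset_left (by omega)
      have h4 : s ∩ t = t := Finset.eq_of_subset_of_card_le Finset.inter_subset_right (by omega)
      exact h3.symm.trans h4
  | insert i V _ ih =>
    rw [Finset.set_biUnion_insert, union_left_comm]
    by_cases hi : face {i} ⊆ face s ∪ face t ∪ ⋃ i ∈ V, face {i}
    · rwa [union_eq_right.2 hi]
    · refine htriv_zero_union hF hinj (isClosed_face _) (hcl V)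
        ((acT_face_singleton hF hinj i).htriv_zero hF hinj (isClosed_face _)) ih ?_
      obtain ⟨x, hx⟩ := exists_face_singleton i
      rw [hx] at hi ⊢
      rwa [disjoint_singleton_left, ← singleton_subset_iff]

end

lemma cellDim_eq_zero {c : Cell} : cellDim c = 0 ↔ ∀ i, Even (c i) := by
  simp [cellDim, Finset.filter_eq_empty_iff]

lemma bdC_projC_zero (z : Chain) : bdC (projC 0 z) = 0 := by
  rw [bdC_eq_sum]
  funext c
  rw [Finset.sum_apply]
  refine Finset.sum_eq_zero fun i _ => ?_
  rw [bdDir_apply]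
  split_ifs with h
  · rw [projC_apply, projC_apply, if_neg, if_neg, add_zero] <;>
      rw [cellDim_update h (by simp [h, parity_simps])] <;> omega
  · rfl

lemma bd_proj_zero (z : DyadicChain) : bd (proj 0 z) = 0 := by
  obtain ⟨n, x, rfl⟩ := exists_lev z
  rw [proj_lev, bd_lev, bdC_projC_zero, map_zero]

/-- The vertex cell with half coordinates `b`. -/
def dbl (b : Fin 3 → ℤ) : Cell := fun i => 2 * b i

/-- The vertex of the grid of level `n` with half coordinates `b`. -/
def pt (n : ℕ) (b : Fin 3 → ℤ) : Fin 3 → ℝ := fun i => 2 * b i / 2 ^ n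

/-- The chain consisting of a single vertex. -/
def vtx (n : ℕ) (b : Fin 3 → ℤ) : DyadicChain := lev n (Pi.single (dbl b) 1)

lemma cellDim_dbl (b : Fin 3 → ℤ) : cellDim (dbl b) = 0 := cellDim_eq_zero.2 fun i => by simp [dbl]

lemma dbl_injective : Function.Injective dbl := fun b b' h => by
  funext i
  have := congrFun h i
  simp only [dbl] at this
  omega

lemma exists_dbl_eq {c : Cell} (h : cellDim c = 0) : ∃ b, dbl b = c := by
  refine ⟨fun i => c i / 2, funext fun i => ?_⟩
  have := cellDim_eq_zero.1 h i
  rw [Int.even_iff] at this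
  simp only [dbl]
  omega

lemma projC_single {k : ℕ} {c : Cell} (h : cellDim c = k) :
    projC k (Pi.single c 1) = Pi.single c 1 := by
  funext d
  rw [projC_apply]
  by_cases hd : d = c
  · subst hd; simp [h]
  · simp [hd]

lemma proj_vtx (n : ℕ) (b : Fin 3 → ℤ) : proj 0 (vtx n b) = vtx n b := by
  rw [vtx, proj_lev, projC_single (cellDim_dbl b)]

lemma bd_vtx (n : ℕ) (b : Fin 3 → ℤ) : bd (vtx n b) = 0 := by rw [← proj_vtx, bd_proj_zero]

lemma mem_cube_dbl {n : ℕ} {b : Fin 3 → ℤ} {x : Fin 3 → ℝ} : x ∈ cube n (dbl b) ↔ x = pt n b := by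
  have hpow : (0 : ℝ) < 2 ^ n := by positivity
  have (i : Fin 3) : ¬ Odd (dbl b i) := by simp [dbl]
  simp only [cube, mem_ofPred_eq, this, if_false, abs_nonpos_iff, sub_eq_zero, funext_iff, pt,
    eq_div_iff hpow.ne', mul_comm]
  simp [dbl, mul_comm]

lemma off_single {n : ℕ} {A : Set (Fin 3 → ℝ)} {c : Cell} (h : Disjoint (cube n c) A) :
    Off n A (Pi.single c 1) := off_iff.2 fun d hd => by
  obtain rfl : d = c := by
    by_contra hne
    exact hd (by simp [hne])
  exact h

lemma vtx_mem_offC {n : ℕ} {b : Fin 3 → ℤ} {A : Set (Fin 3 → ℝ)} (h : pt n b ∉ A) :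
    vtx n b ∈ offC A := by
  refine lev_mem_offC (off_single (Set.disjoint_left.2 fun x hx => ?_))
  rwa [mem_cube_dbl.1 hx]

lemma sd_single_dbl (b : Fin 3 → ℤ) :
    sd (Pi.single (dbl b) 1) = Pi.single (dbl (dbl b)) 1 := by
  funext c
  rw [sd_apply]
  by_cases hc : c = dbl (dbl b)
  · subst hc
    rw [if_neg, Pi.single_eq_same]
    · have h : (fun i => parent (dbl (dbl b) i)) = dbl b := by
        funext i
        unfold parent dbl
        split_ifs <;> omega
      rw [h, Pi.single_eq_same]
    · simp only [dbl, not_exists]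
      omega
  · rw [Pi.single_eq_of_ne hc]
    split_ifs with h
    · rfl
    · refine Pi.single_eq_of_ne (fun h1 => hc (funext fun i => ?_)) _
      have h2 := congrFun h1 i
      have h3 : c i % 4 ≠ 2 := fun h4 => h ⟨i, h4⟩
      simp only [parent, dbl] at h2 ⊢
      split_ifs at h2 <;> omega

lemma vtx_dbl (n : ℕ) (b : Fin 3 → ℤ) : vtx (n + 1) (dbl b) = vtx n b := by
  rw [vtx, vtx, ← sd_single_dbl, lev_sd]

lemma pt_dbl (n : ℕ) (b : Fin 3 → ℤ) : pt (n + 1) (dbl b) = pt n b := by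
  funext i
  simp only [pt, dbl, pow_succ]
  push_cast
  field_simp

lemma exists_vtx_eq {n m : ℕ} (h : n ≤ m) (b : Fin 3 → ℤ) :
    ∃ b', vtx m b' = vtx n b ∧ pt m b' = pt n b := by
  induction m, h using Nat.le_induction with
  | base => exact ⟨b, rfl, rfl⟩
  | succ m _ ih =>
    obtain ⟨b', h1, h2⟩ := ih
    exact ⟨dbl b', by rw [vtx_dbl, h1], by rw [pt_dbl, h2]⟩

lemma bdC_single_edge (b : Fin 3 → ℤ) (i : Fin 3) :
    bdC (Pi.single (Function.update (dbl b) i (2 * b i + 1)) 1) =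
      Pi.single (dbl b) 1 + Pi.single (dbl (Function.update b i (b i + 1))) 1 := by
  have hd : dbl (Function.update b i (b i + 1)) = Function.update (dbl b) i (2 * b i + 2) := by
    funext j
    by_cases hj : j = i
    · subst hj; simp [dbl]; ring
    · simp [dbl, hj]
  rw [hd, bdC_eq_sum]
  funext c
  rw [Finset.sum_apply, Finset.sum_eq_single i]
  · rw [bdDir_apply, Pi.add_apply]
    simp only [Pi.single_apply]
    by_cases hc : ∃ a, c = Function.update (dbl b) i a
    · obtain ⟨a, rfl⟩ := hc
      have hinj (x y : ℤ) : Function.update (dbl b) i x = Function.update (dbl b) i y ↔ x = y :=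
        (Function.update_injective (dbl b) i).eq_iff
      have h0 : dbl b = Function.update (dbl b) i (2 * b i) := by simp [dbl]
      conv_rhs => rw [h0]
      simp only [Function.update_idem, Function.update_self, hinj]
      by_cases ha : Even a
      · rw [if_pos ha]
        obtain ⟨m, rfl⟩ := ha
        have e1 : m + m + 1 = 2 * b i + 1 ↔ m + m = 2 * b i := by omega
        have e2 : m + m - 1 = 2 * b i + 1 ↔ m + m = 2 * b i + 2 := by omega
        simp only [e1, e2]
      · rw [if_neg ha, if_neg, if_neg, add_zero]
        · rintro rfl; exact ha (by simp [parity_simps])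
        · rintro rfl; exact ha (by simp [parity_simps])
    · have h1 (x y : ℤ) : Function.update c i x ≠ Function.update (dbl b) i y := fun h => by
        refine hc ⟨c i, ?_⟩
        have := congrArg (fun f => Function.update f i (c i)) h
        simpa using this
      have h2 (y : ℤ) : c ≠ Function.update (dbl b) i y := fun h => hc ⟨y, h⟩
      have h3 : c ≠ dbl b := fun h => hc ⟨dbl b i, by simpa using h⟩
      simp [h1, h2, h3]
  · intro j _ hj
    rw [bdDir_apply]
    split_ifs with h
    · have key (a : ℤ) (ha : Odd a) :
          Function.update c j a ≠ Function.update (dbl b) i (2 * b i + 1) := fun h1 => by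
        have := congrFun h1 j
        rw [Function.update_self, Function.update_of_ne hj] at this
        rw [this] at ha
        exact absurd ha (by simp [dbl])
      rw [Pi.single_eq_of_ne (key _ (by simp [h, parity_simps])),
        Pi.single_eq_of_ne (key _ (by simp [h, parity_simps])), add_zero]
    · rfl
  · simp

lemma pt_mono {n : ℕ} {b b' : Fin 3 → ℤ} (h : b ≤ b') : pt n b ≤ pt n b' := fun i => by
  have : (b i : ℝ) ≤ b' i := by exact_mod_cast h i
  simp only [pt]
  gcongr

lemma isBd_edge {n : ℕ} {b : Fin 3 → ℤ} {i : Fin 3} {A : Set (Fin 3 → ℝ)}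
    (h : Disjoint (Icc (pt n b) (pt n (Function.update b i (b i + 1)))) A) :
    IsBd A (vtx n b + vtx n (Function.update b i (b i + 1))) := by
  refine ⟨lev n (Pi.single (Function.update (dbl b) i (2 * b i + 1)) 1),
    lev_mem_offC (off_single (h.mono_left fun x hx => ?_)), ?_⟩
  · have hpow : (0 : ℝ) < 2 ^ n := by positivity
    refine ⟨fun j => ?_, fun j => ?_⟩
    all_goals
      have hj := hx j
      simp only [pt]
      by_cases hji : j = i
      · subst hji
        rw [Function.update_self, if_pos (by simp), abs_le] at hj
        push_cast at hj
        first
        | rw [div_le_iff₀ hpow]; linarith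
        | rw [Function.update_self, le_div_iff₀ hpow]; push_cast; linarith
      · rw [Function.update_of_ne hji, if_neg (by simp [dbl]), abs_nonpos_iff] at hj
        simp only [dbl] at hj
        push_cast at hj
        first
        | rw [div_le_iff₀ hpow]; linarith
        | rw [Function.update_of_ne hji, le_div_iff₀ hpow]; linarith
  · rw [bd_lev, bdC_single_edge, map_add, vtx, vtx]

lemma isBd_add_trans {A : Set (Fin 3 → ℝ)} {x y z : DyadicChain} (h : IsBd A (x + y))
    (h' : IsBd A (y + z)) : IsBd A (x + z) := by
  have := h.add h'
  rwa [show x + y + (y + z) = x + z + (y + y) by abel, ZModModule.add_self, add_zero] at this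

lemma isBd_add_comm {A : Set (Fin 3 → ℝ)} {x y : DyadicChain} (h : IsBd A (x + y)) :
    IsBd A (y + x) := add_comm x y ▸ h

lemma isBd_of_le {n : ℕ} {b b' : Fin 3 → ℤ} {A : Set (Fin 3 → ℝ)} (hle : b ≤ b')
    (h : Disjoint (Icc (pt n b) (pt n b')) A) : IsBd A (vtx n b + vtx n b') := by
  obtain ⟨k, hk⟩ : ∃ k : ℕ, ∑ i, (b' i - b i) = k :=
    Int.eq_ofNat_of_zero_le (Finset.sum_nonneg fun i _ => sub_nonneg.2 (hle i))
  induction k generalizing b with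
  | zero =>
    have : b = b' := by
      funext i
      have := (Finset.sum_eq_zero_iff_of_nonneg fun i _ => sub_nonneg.2 (hle i)).1 hk i
        (Finset.mem_univ i)
      omega
    rw [this, ZModModule.add_self]
    exact isBd_zero
  | succ k ih =>
    obtain ⟨i, -, hi⟩ : ∃ i ∈ Finset.univ, 0 < b' i - b i :=
      Finset.exists_lt_of_sum_lt (by simp [hk])
    have h1 : b ≤ Function.update b i (b i + 1) := fun j => by
      by_cases hj : j = i
      · subst hj; simp
      · simp [hj]
    have h2 : Function.update b i (b i + 1) ≤ b' := fun j => by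
      by_cases hj : j = i
      · subst hj; simp; omega
      · simpa [hj] using hle j
    refine isBd_add_trans (isBd_edge (h.mono_left (Icc_subset_Icc_right (pt_mono h2))))
      (ih h2 (h.mono_left (Icc_subset_Icc_left (pt_mono h1))) ?_)
    have : ∑ j, (b' j - Function.update b i (b i + 1) j) = ∑ j, (b' j - b j) - 1 := by
      rw [Finset.sum_sub_distrib, Finset.sum_sub_distrib,
        Finset.sum_update_of_mem (Finset.mem_univ i),
        ← Finset.add_sum_erase _ b (Finset.mem_univ i), Finset.sdiff_singleton_eq_erase]
      ring
    rw [this, hk]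
    push_cast
    ring

lemma isBd_of_mem_closedBall {n : ℕ} {b b' : Fin 3 → ℤ} {A : Set (Fin 3 → ℝ)} {p : Fin 3 → ℝ}
    {r : ℝ} (hb : pt n b ∈ Metric.closedBall p r) (hb' : pt n b' ∈ Metric.closedBall p r)
    (h : Disjoint (Metric.closedBall p r) A) : IsBd A (vtx n b + vtx n b') := by
  have hr : 0 ≤ r := dist_nonneg.trans hb
  have hinf : pt n (b ⊓ b') = pt n b ⊓ pt n b' := by
    funext i
    simp only [pt, Pi.inf_apply]
    rcases le_total (b i) (b' i) with h | h
    · rw [inf_eq_left.2 h, inf_eq_left.2]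
      have : (b i : ℝ) ≤ b' i := by exact_mod_cast h
      gcongr
    · rw [inf_eq_right.2 h, inf_eq_right.2]
      have : (b' i : ℝ) ≤ b i := by exact_mod_cast h
      gcongr
  have hicc : Metric.closedBall p r = Icc (fun i => p i - r) (fun i => p i + r) := by
    ext x
    rw [Metric.mem_closedBall, dist_pi_le_iff hr, mem_Icc, Pi.le_def, Pi.le_def, ← forall_and]
    refine forall_congr' fun i => ?_
    rw [Real.dist_eq, abs_le]
    constructor <;> rintro ⟨h1, h2⟩ <;> constructor <;> linarith
  rw [hicc] at h hb hb'
  have h0 : pt n (b ⊓ b') ∈ Icc (fun i => p i - r) (fun i => p i + r) := by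
    rw [hinf]
    exact ⟨le_inf hb.1 hb'.1, inf_le_left.trans hb.2⟩
  exact isBd_add_trans
    (isBd_add_comm (isBd_of_le inf_le_left (h.mono_left (Icc_subset_Icc h0.1 hb.2))))
    (isBd_of_le inf_le_right (h.mono_left (Icc_subset_Icc h0.1 hb'.2)))

/-- Half coordinates of a grid vertex close to a point. -/
def rnd (n : ℕ) (x : Fin 3 → ℝ) : Fin 3 → ℤ := fun i => ⌊2 ^ n * x i / 2⌋

lemma dist_pt_rnd_le (n : ℕ) (x : Fin 3 → ℝ) : dist (pt n (rnd n x)) x ≤ 2 / 2 ^ n := by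
  have hpow : (0 : ℝ) < 2 ^ n := by positivity
  refine (dist_pi_le_iff (by positivity)).2 fun i => ?_
  have h1 := Int.floor_le (2 ^ n * x i / 2)
  have h2 := Int.lt_floor_add_one (2 ^ n * x i / 2)
  have h3 : |(pt n (rnd n x) i - x i) * 2 ^ n| ≤ 2 := by
    simp only [pt, rnd]
    rw [sub_mul, div_mul_cancel₀ _ hpow.ne', abs_le]
    constructor <;> linarith
  rwa [abs_mul, abs_of_pos hpow, ← Real.dist_eq, ← le_div_iff₀ hpow] at h3

lemma rnd_pt (n : ℕ) (b : Fin 3 → ℤ) : rnd n (pt n b) = b := by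
  funext i
  simp only [rnd, pt]
  rw [show (2 : ℝ) ^ n * (2 * b i / 2 ^ n) / 2 = b i by field_simp]
  exact Int.floor_intCast _

lemma vtx_rnd_pt {n m : ℕ} (h : n ≤ m) (b : Fin 3 → ℤ) : vtx m (rnd m (pt n b)) = vtx n b := by
  obtain ⟨b', h1, h2⟩ := exists_vtx_eq h b
  rw [← h2, rnd_pt, h1]

lemma tendsto_pt_rnd (x : Fin 3 → ℝ) :
    Filter.Tendsto (fun n => pt n (rnd n x)) Filter.atTop (nhds x) := by
  rw [tendsto_iff_dist_tendsto_zero]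
  refine squeeze_zero (fun _ => dist_nonneg) (fun n => dist_pt_rnd_le n x) ?_
  have := (tendsto_pow_atTop_nhds_zero_of_lt_one (r := (1 / 2 : ℝ)) (by norm_num)
    (by norm_num)).const_mul 2
  simpa [div_eq_mul_inv] using this

/-- Points joined by a preconnected set in the complement of `A` are homologous off `A`. -/
lemma eventually_isBd_of_isPreconnected {A C : Set (Fin 3 → ℝ)} (hA : IsClosed A)
    (hC : IsPreconnected C) (hCA : Disjoint C A) {x y : Fin 3 → ℝ} (hx : x ∈ C) (hy : y ∈ C) :
    ∀ᶠ n in Filter.atTop, IsBd A (vtx n (rnd n x) + vtx n (rnd n y)) := by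
  set R : (Fin 3 → ℝ) → (Fin 3 → ℝ) → Prop := fun x y =>
    ∀ᶠ n in Filter.atTop, IsBd A (vtx n (rnd n x) + vtx n (rnd n y)) with hR
  have hloc (p : Fin 3 → ℝ) (hp : p ∈ Aᶜ) : ∃ U, IsOpen U ∧ p ∈ U ∧ ∀ q ∈ U, R p q := by
    obtain ⟨r, hr, hsub⟩ := Metric.nhds_basis_closedBall.mem_iff.1 (hA.isOpen_compl.mem_nhds hp)
    refine ⟨Metric.ball p r, Metric.isOpen_ball, Metric.mem_ball_self hr, fun q hq => ?_⟩
    filter_upwards [(tendsto_pt_rnd p).eventually (Metric.closedBall_mem_nhds p hr),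
      (tendsto_pt_rnd q).eventually (Metric.closedBall_mem_nhds_of_mem hq)] with n h1 h2
    exact isBd_of_mem_closedBall h1 h2 (disjoint_left.2 fun x hx => hsub hx)
  have hsymm {x y} (h : R x y) : R y x := h.mono fun n => isBd_add_comm
  have htrans {x y z} (h : R x y) (h' : R y z) : R x z := by
    filter_upwards [h, h'] with n using isBd_add_trans
  choose! U hU hpU hUR using hloc
  have hsub := hC.subset_left_of_subset_union (u := ⋃ p ∈ {p | p ∈ Aᶜ ∧ R x p}, U p)
    (v := ⋃ p ∈ {p | p ∈ Aᶜ ∧ ¬ R x p}, U p) (isOpen_biUnion fun p hp => hU p hp.1)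
    (isOpen_biUnion fun p hp => hU p hp.1) ?_ ?_ ⟨x, hx, ?_⟩
  · have h := hsub hy
    simp only [mem_iUnion] at h
    obtain ⟨p, hp, hq⟩ := h
    exact htrans hp.2 (hUR p hp.1 y hq)
  · rw [disjoint_left]
    simp only [mem_iUnion, not_exists]
    rintro q ⟨p, hp, hq⟩ p' hp' hq'
    exact hp'.2 (htrans hp.2 (htrans (hUR p hp.1 q hq) (hsymm (hUR p' hp'.1 q hq'))))
  · intro q hq
    have hqA : q ∈ Aᶜ := disjoint_left.1 hCA hq
    by_cases h : R x q
    · exact Or.inl (mem_biUnion (show q ∈ {p | p ∈ Aᶜ ∧ R x p} from ⟨hqA, h⟩) (hpU q hqA))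
    · exact Or.inr (mem_biUnion (show q ∈ {p | p ∈ Aᶜ ∧ ¬ R x p} from ⟨hqA, h⟩) (hpU q hqA))
  · have hxA : x ∈ Aᶜ := disjoint_left.1 hCA hx
    exact mem_biUnion (show x ∈ {p | p ∈ Aᶜ ∧ R x p} from ⟨hxA, hUR x hxA x (hpU x hxA)⟩)
      (hpU x hxA)

lemma isBd_vtx_add_vtx {A C : Set (Fin 3 → ℝ)} (hA : IsClosed A)
    (hC : IsPreconnected C) (hCA : Disjoint C A) {n m : ℕ} {b b' : Fin 3 → ℤ} (hb : pt n b ∈ C)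
    (hb' : pt m b' ∈ C) : IsBd A (vtx n b + vtx m b') := by
  obtain ⟨k, hk, h1, h2⟩ := ((eventually_isBd_of_isPreconnected hA hC hCA hb hb').and
    ((Filter.eventually_ge_atTop n).and (Filter.eventually_ge_atTop m))).exists
  rwa [vtx_rnd_pt h1, vtx_rnd_pt h2] at hk

/-- A vertex lying in an unbounded preconnected set of the complement of `A` bounds off `A`. -/
lemma isBd_vtx_of_not_isBounded {A C : Set (Fin 3 → ℝ)} (hA : IsCompact A) (hCo : IsOpen C)
    (hC : IsPreconnected C) (hCA : Disjoint C A) {n : ℕ} {b : Fin 3 → ℤ} (hb : pt n b ∈ C)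
    (hun : ¬ Bornology.IsBounded C) : IsBd A (vtx n b) := by
  obtain ⟨r, hr⟩ := hA.isBounded.subset_closedBall 0
  have hbox : A ⊆ Icc (fun _ => -r) (fun _ => r) := fun x hx => by
    have := hr hx
    rw [mem_closedBall_zero_iff] at this
    have h1 (i : Fin 3) := abs_le.1 ((norm_le_pi_norm x i).trans this)
    exact ⟨fun i => (h1 i).1, fun i => (h1 i).2⟩
  rcases A.eq_empty_or_nonempty with rfl | ⟨a, ha⟩
  · exact htriv_empty (by norm_num) _ (mem_offC_empty _) (proj_vtx n b) (bd_vtx n b)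
  have hle : (fun _ => -r : Fin 3 → ℝ) ≤ fun _ => r := (hbox ha).1.trans (hbox ha).2
  obtain ⟨p, hpC, hp⟩ : ∃ p ∈ C, p ∉ Icc (fun _ => -r : Fin 3 → ℝ) (fun _ => r) := by
    by_contra! h
    exact hun ((Metric.isBounded_Icc _ _).subset h)
  obtain ⟨m, hm⟩ := ((tendsto_pt_rnd p).eventually
    ((hCo.inter isClosed_Icc.isOpen_compl).mem_nhds ⟨hpC, hp⟩)).exists
  have h1 := isBd_vtx_add_vtx hA.isClosed hC hCA hb hm.1
  have h2 := (isBd_Icc hle (vtx_mem_offC hm.2) (bd_vtx _ _)).anti hbox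
  have := h1.add h2
  rwa [add_assoc, ZModModule.add_self, add_zero] at this

/-- A set containing every preconnected subset of the complement of `A` that it meets. -/
def Saturated (A V : Set (Fin 3 → ℝ)) : Prop :=
  ∀ C, IsPreconnected C → Disjoint C A → (C ∩ V).Nonempty → C ⊆ V

lemma finite_pt_mem (n : ℕ) {V : Set (Fin 3 → ℝ)} (hV : Bornology.IsBounded V) :
    {b | pt n b ∈ V}.Finite :=
  ((finite_cube_inter n hV).preimage dbl_injective.injOn).subset fun b hb =>
    ⟨pt n b, mem_cube_dbl.2 rfl, hb⟩

lemma convex_cube (n : ℕ) (c : Cell) : Convex ℝ (cube n c) := by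
  have : cube n c = ⋂ i, {x : Fin 3 → ℝ | |2 ^ n * x i - c i| ≤ if Odd (c i) then 1 else 0} := by
    ext x; simp [cube]
  rw [this]
  refine convex_iInter fun i x hx y hy a b ha hb hab => ?_
  simp only [mem_ofPred_eq, abs_le] at *
  have hc : (c i : ℝ) = a * c i + b * c i := by rw [← add_mul, hab, one_mul]
  generalize (if Odd (c i) then (1 : ℝ) else 0) = e at *
  have he : e = a * e + b * e := by rw [← add_mul, hab, one_mul]
  simp only [Pi.add_apply, Pi.smul_apply, smul_eq_mul]
  constructor <;> nlinarith [mul_le_mul_of_nonneg_left hx.1 ha, mul_le_mul_of_nonneg_left hy.1 hb,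
    mul_le_mul_of_nonneg_left hx.2 ha, mul_le_mul_of_nonneg_left hy.2 hb]

lemma sum_bdC_eq_zero {n : ℕ} {A V : Set (Fin 3 → ℝ)} (hV : Bornology.IsBounded V)
    (hsat : Saturated A V) {y : Chain} (hy : Off n A y) :
    ∑ b ∈ (finite_pt_mem n hV).toFinset, bdC y (dbl b) = 0 := by
  simp only [bdC_eq_sum, Finset.sum_apply]
  rw [Finset.sum_comm]
  refine Finset.sum_eq_zero fun i _ => ?_
  have heven (b : Fin 3 → ℤ) : Even (dbl b i) := by simp [dbl]
  simp only [bdDir_apply, heven, if_true]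
  rw [Finset.sum_add_distrib]
  suffices h : ∑ b ∈ (finite_pt_mem n hV).toFinset, y (Function.update (dbl b) i (dbl b i + 1)) =
      ∑ b ∈ (finite_pt_mem n hV).toFinset, y (Function.update (dbl b) i (dbl b i - 1)) by
    rw [h, CharTwo.add_self_eq_zero]
  have hshift (b : Fin 3 → ℤ) (s : ℤ) : dbl (Function.update b i (b i + s)) =
      Function.update (dbl b) i (dbl b i + 2 * s) := by
    funext j
    by_cases hj : j = i
    · subst hj; simp [dbl]; ring
    · simp [dbl, hj]
  have key (b b' : Fin 3 → ℤ) (d : Cell) (hd : y d ≠ 0) (hbd : cube n (dbl b) ⊆ cube n d)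
      (hbd' : cube n (dbl b') ⊆ cube n d) (hb : pt n b ∈ V) : pt n b' ∈ V :=
    hsat _ (convex_cube n d).isPreconnected (off_iff.1 hy d hd)
      ⟨_, hbd (mem_cube_dbl.2 rfl), hb⟩ (hbd' (mem_cube_dbl.2 rfl))
  refine Finset.sum_bij_ne_zero (fun b _ _ => Function.update b i (b i + 1)) ?_ ?_ ?_ ?_
  · intro b hb hne
    simp only [Finite.mem_toFinset, mem_ofPred_eq] at hb ⊢
    refine key _ _ _ hne (cube_update_subset n (heven b) (Or.inl rfl)) ?_ hb
    have := cube_update_subset n (heven (Function.update b i (b i + 1))) (Or.inr rfl)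
    convert this using 2
    rw [hshift, Function.update_idem, Function.update_self]
    congr 1
    ring
  · intro b _ _ b' _ _ h
    have := congrArg (fun f => Function.update f i (f i - 1)) h
    simpa using this
  · intro b hb hne
    simp only [Finite.mem_toFinset, mem_ofPred_eq] at hb
    refine ⟨Function.update b i (b i - 1), ?_, ?_, ?_⟩
    · simp only [Finite.mem_toFinset, mem_ofPred_eq]
      refine key _ _ _ hne (cube_update_subset n (heven b) (Or.inr rfl)) ?_ hb
      have := cube_update_subset n (heven (Function.update b i (b i - 1))) (Or.inl rfl)
      convert this using 2
      rw [sub_eq_add_neg (b i), hshift, Function.update_idem, Function.update_self]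
      congr 1
      ring
    · rw [sub_eq_add_neg (b i), hshift, Function.update_idem, Function.update_self]
      convert hne using 2
      congr 1
      ring
    · simp
  · intro b _ _
    rw [hshift, Function.update_idem, Function.update_self]
    congr 2
    ring

lemma not_isBd_vtx_add_vtx {A V : Set (Fin 3 → ℝ)} (hV : Bornology.IsBounded V)
    (hsat : Saturated A V) {n m : ℕ} {b b' : Fin 3 → ℤ} (hb : pt n b ∈ V) (hb' : pt m b' ∉ V) :
    ¬ IsBd A (vtx n b + vtx m b') := by
  rintro ⟨w, hw, h⟩
  obtain ⟨k, y, hk, rfl, hy⟩ := exists_off_ge hw (max n m)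
  obtain ⟨c, hc, hcp⟩ := exists_vtx_eq ((le_max_left n m).trans hk) b
  obtain ⟨c', hc', hcp'⟩ := exists_vtx_eq ((le_max_right n m).trans hk) b'
  rw [bd_lev, ← hc, ← hc', vtx, vtx, ← map_add] at h
  have h1 := sum_bdC_eq_zero hV hsat hy
  rw [lev_injective k h] at h1
  have h2 (a : Fin 3 → ℤ) :
      ∑ b ∈ (finite_pt_mem k hV).toFinset, (Pi.single (dbl a) 1 : Chain) (dbl b) =
        if a ∈ (finite_pt_mem k hV).toFinset then 1 else 0 := by
    simp [Pi.single_apply, dbl_injective.eq_iff]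
  simp only [Pi.add_apply, Finset.sum_add_distrib, h2] at h1
  simp [hcp, hcp', hb, hb'] at h1

lemma not_isBd_vtx {A V : Set (Fin 3 → ℝ)} (hV : Bornology.IsBounded V)
    (hsat : Saturated A V) {n : ℕ} {b : Fin 3 → ℤ} (hb : pt n b ∈ V) : ¬ IsBd A (vtx n b) := by
  rintro ⟨w, hw, h⟩
  obtain ⟨k, y, hk, rfl, hy⟩ := exists_off_ge hw n
  obtain ⟨c, hc, hcp⟩ := exists_vtx_eq hk b
  rw [bd_lev, ← hc, vtx] at h
  have h1 := sum_bdC_eq_zero hV hsat hy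
  rw [lev_injective k h] at h1
  simp [Pi.single_apply, dbl_injective.eq_iff, hcp, hb] at h1

/-- A dyadic chain is finite if it is represented by a finite chain of some grid. -/
def IsFin (z : DyadicChain) : Prop := ∃ n x, Bornology.IsBounded (carrier n x) ∧ lev n x = z

lemma isBounded_cube (n : ℕ) (c : Cell) : Bornology.IsBounded (cube n c) := by
  refine Metric.isBounded_closedBall (x := fun i => (c i : ℝ) / 2 ^ n) (r := 1) |>.subset
    fun x hx => (dist_pi_le_iff zero_le_one).2 fun i => ?_
  have hpow : (1 : ℝ) ≤ 2 ^ n := one_le_pow₀ (by norm_num)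
  have h := (hx i).trans (show (if Odd (c i) then (1 : ℝ) else 0) ≤ 1 by split_ifs <;> norm_num)
  rw [show 2 ^ n * x i - c i = 2 ^ n * (x i - c i / 2 ^ n) by field_simp, abs_mul,
    abs_of_pos (by positivity)] at h
  rw [Real.dist_eq]
  nlinarith [abs_nonneg (x i - c i / 2 ^ n)]

lemma isBounded_carrier (n : ℕ) {x : Chain} (hx : x.support.Finite) :
    Bornology.IsBounded (carrier n x) := by
  have : Finite {c // x c ≠ 0} := hx
  exact Bornology.isBounded_iUnion.2 fun c => isBounded_cube n c

lemma cube_nonempty (n : ℕ) (c : Cell) : (cube n c).Nonempty := by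
  refine ⟨fun i => (c i : ℝ) / 2 ^ n, fun i => ?_⟩
  rw [mul_div_cancel₀ _ (by positivity), sub_self, abs_zero]
  split_ifs <;> norm_num

lemma finite_support {n : ℕ} {x : Chain} (hx : Bornology.IsBounded (carrier n x)) :
    x.support.Finite :=
  (finite_cube_inter n hx).subset fun c hc => by
    rw [mem_ofPred_eq, inter_eq_left.2 (cube_subset_carrier hc)]
    exact cube_nonempty n c

lemma IsFin.exists_off {z : DyadicChain} {A : Set (Fin 3 → ℝ)} (h : IsFin z) (hz : z ∈ offC A) :
    ∃ n x, x.support.Finite ∧ Off n A x ∧ lev n x = z := by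
  obtain ⟨n, x, hx, rfl⟩ := h
  obtain ⟨m, y, hm, hy, hoff⟩ := exists_off_ge hz n
  rw [← lev_sdPow hm] at hy
  have hy := lev_injective m hy
  exact ⟨m, y, finite_support (hx.subset (hy ▸ carrier_sdPow_subset hm x)), hoff, by
    rw [hy, lev_sdPow]⟩

lemma IsFin.bd {z : DyadicChain} (h : IsFin z) : IsFin (bd z) := by
  obtain ⟨n, x, hx, rfl⟩ := h
  exact ⟨n, bdC x, hx.subset (carrier_bdC_subset n x), (bd_lev n x).symm⟩

lemma IsFin.proj {z : DyadicChain} (k : ℕ) (h : IsFin z) : IsFin (proj k z) := by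
  obtain ⟨n, x, hx, rfl⟩ := h
  exact ⟨n, projC k x, hx.subset (carrier_mono fun c hc h => hc (by simp [projC_apply, h])),
    (proj_lev k n x).symm⟩

section

variable {Γ : Type*} [TopologicalSpace Γ] [CompactSpace Γ] {F : Γ × Circle → Fin 3 → ℝ}

lemma AcT.isBd_iff (hF : Continuous F) (hinj : Function.Injective F) {T T' : Set Γ}
    (hT : IsClosed T) (hT' : IsClosed T') (h : AcT F T) (h' : AcT F T') (hsub : T' ⊆ T)
    {z : DyadicChain} (hz : z ∈ offC (F '' (T ×ˢ univ))) (hk : proj 1 z = z) (hbd : bd z = 0) :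
    IsBd (F '' (T' ×ˢ univ)) z ↔ IsBd (F '' (T ×ˢ univ)) z :=
  ⟨AcT.isBd_of_subset hF hinj hT hT' h h' hsub hz hk hbd,
    fun h => h.anti (image_mono (prod_mono_left hsub))⟩

/-- A cycle of degree zero linked with the torus over the circle `E ∪ P`, and bounding in the
complement of the part `S` of the product. -/
lemma exists_linking_cycle (hF : Continuous F) (hinj : Function.Injective F)
    {E P S C₀ C₁ : Set Γ} (hE : IsClosed E) (hP : IsClosed P) (hS : IsClosed S)
    (hC₀ : IsClosed C₀) (hC₁ : IsClosed C₁) (aE : AcT F E) (aP : AcT F P) (aC₀ : AcT F C₀)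
    (aC₁ : AcT F C₁) (hPS : P ⊆ S) (hES : E ∩ S = C₀ ∪ C₁) (hCP : C₀ ∪ C₁ ⊆ P)
    (hd : Disjoint C₀ C₁) :
    ∃ δ ∈ offC (F '' ((E ∪ S) ×ˢ univ)), IsFin δ ∧ proj 0 δ = δ ∧
      IsBd (F '' (S ×ˢ univ)) δ ∧ ¬ IsBd (F '' ((E ∪ P) ×ˢ univ)) δ := by
  have hc {T : Set Γ} (hT : IsClosed T) : IsCompact (F '' (T ×ˢ (univ : Set Circle))) :=
    isCompact_prod_image hF hT isClosed_univ
  have hCE : C₀ ∪ C₁ ⊆ E := hES ▸ inter_subset_left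
  obtain ⟨l, -, hl₁⟩ := AcT.exists_gen hF hinj hE hC₁ aE aC₁ (subset_union_right.trans hCE)
  obtain ⟨w, hw, hwk, hwl⟩ := (htriv_empty (by norm_num) l (mem_offC_empty _) hl₁.proj_eq
    hl₁.bd_eq).exists_proj hl₁.proj_eq
  obtain ⟨w₀, hw₀, w₁, hw₁, hk₀, hk₁, rfl⟩ := exists_split_proj (hc hC₀) (hc hC₁) (z := w)
    (by rwa [prod_image_inter hinj, hd.inter_eq, empty_prod, image_empty]) hwk
  have hz₀ : IsBd (F '' (C₀ ×ˢ univ)) (bd w₀) := ⟨w₀, hw₀, rfl⟩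
  have hzl : bd w₀ = bd w₁ + l := by
    rw [← hwl, map_add, add_left_comm, ZModModule.add_self, add_zero]
  have hz₁ : IsBd (F '' (C₁ ×ˢ univ)) (bd w₀ + l) :=
    ⟨w₁, hw₁, by rw [hzl, add_assoc, ZModModule.add_self, add_zero]⟩
  have hnz₁ : ¬ IsBd (F '' (C₁ ×ˢ univ)) (bd w₀) := fun h => hl₁.not_isBd <| by
    have := h.add hz₁
    rwa [← add_assoc, ZModModule.add_self, zero_add] at this
  have hzk : proj 1 (bd w₀) = bd w₀ := by rw [← bd_proj, hk₀]
  have hzoff : bd w₀ ∈ offC (F '' (E ×ˢ univ) ∩ F '' (S ×ˢ univ)) := by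
    rw [prod_image_inter hinj, inter_self, hES, union_prod, image_union]
    refine mem_offC_union hz₀.mem_offC ?_
    rw [hzl]
    exact add_mem (bd_mem_offC hw₁) hl₁.mem
  generalize bd w₀ = z at *
  have hzbd := hz₀.bd_eq_zero
  obtain ⟨n, x, hxfin, hxE, b, hb, hxb⟩ := exists_split (hc hE) (hc hS) hzoff
  obtain ⟨a, ha⟩ : ∃ a, a = proj 1 (lev n x) := ⟨_, rfl⟩
  obtain ⟨b', hb'⟩ : ∃ b', b' = proj 1 b := ⟨_, rfl⟩
  have haE : a ∈ offC (F '' (E ×ˢ univ)) := ha ▸ proj_mem_offC _ (lev_mem_offC hxE)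
  have hbS : b' ∈ offC (F '' (S ×ˢ univ)) := hb' ▸ proj_mem_offC _ hb
  have hab : a + b' = z := by rw [ha, hb', ← map_add, hxb, hzk]
  have hak : proj 1 a = a := by rw [ha, proj_proj]
  have hbk : proj 1 b' = b' := by rw [hb', proj_proj]
  have hfin : IsFin a := ha ▸ IsFin.proj 1 ⟨n, x, isBounded_carrier n hxfin, rfl⟩
  have hδ : bd a = bd b' := by
    rw [← sub_eq_zero, ZModModule.sub_eq_add, ← map_add, hab, hzbd]
  refine ⟨bd a, ?_, hfin.bd, by rw [← bd_proj, hak], ⟨b', hbS, hδ.symm⟩, fun h => ?_⟩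
  · rw [union_prod, image_union]
    exact mem_offC_union (bd_mem_offC haE) (hδ ▸ bd_mem_offC hbS)
  obtain ⟨v, hv, hvk, hva⟩ := h.exists_proj (k := 0) (by rw [← bd_proj, hak])
  have hsub {T T' : Set Γ} (h : T ⊆ T') : F '' (T ×ˢ (univ : Set Circle)) ⊆ F '' (T' ×ˢ univ) :=
    image_mono (prod_mono_left h)
  have hcE : a + v ∈ offC (F '' (E ×ˢ univ)) := add_mem haE (offC_anti (hsub subset_union_left) hv)
  have hcP : b' + v ∈ offC (F '' (P ×ˢ univ)) :=
    add_mem (offC_anti (hsub hPS) hbS) (offC_anti (hsub subset_union_right) hv)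
  have hEbd : bd (a + v) = 0 := by rw [map_add, hva, ZModModule.add_self]
  have hPbd : bd (b' + v) = 0 := by rw [map_add, hva, hδ, ZModModule.add_self]
  have hEk : proj 1 (a + v) = a + v := by rw [map_add, hak, hvk]
  have hPk : proj 1 (b' + v) = b' + v := by rw [map_add, hbk, hvk]
  have hsum : a + v + (b' + v) = z := by
    rw [add_add_add_comm, ZModModule.add_self, add_zero, hab]
  have hE₀ := AcT.isBd_iff hF hinj hE hC₀ aE aC₀ (subset_union_left.trans hCE) hcE hEk hEbd
  have hE₁ := AcT.isBd_iff hF hinj hE hC₁ aE aC₁ (subset_union_right.trans hCE) hcE hEk hEbd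
  have hP₀ := AcT.isBd_iff hF hinj hP hC₀ aP aC₀ (subset_union_left.trans hCP) hcP hPk hPbd
  have hP₁ := AcT.isBd_iff hF hinj hP hC₁ aP aC₁ (subset_union_right.trans hCP) hcP hPk hPbd
  generalize a + v = c at *
  generalize b' + v = d at *
  have hiff : IsBd (F '' (C₀ ×ˢ univ)) c ↔ IsBd (F '' (C₀ ×ˢ univ)) d := by
    constructor <;> intro h <;> have := h.add hz₀ <;> rw [← hsum] at this
    · rwa [← add_assoc, ZModModule.add_self, zero_add] at this
    · rwa [add_left_comm, ZModModule.add_self, add_zero] at this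
  by_cases h : IsBd (F '' (C₀ ×ˢ univ)) c
  · exact hnz₁ (hsum ▸ (hE₁.2 (hE₀.1 h)).add (hP₁.2 (hP₀.1 (hiff.1 h))))
  · have h1 : ¬ IsBd (F '' (C₁ ×ˢ univ)) c := fun h' => h (hE₀.2 (hE₁.1 h'))
    have h2 : ¬ IsBd (F '' (C₁ ×ˢ univ)) d := fun h' => h (hiff.2 (hP₀.2 (hP₁.1 h')))
    have h1 := (hl₁.span c (offC_anti (hsub (subset_union_right.trans hCE)) hcE) hEk
      hEbd).resolve_left h1
    have h2 := (hl₁.span d (offC_anti (hsub (subset_union_right.trans hCP)) hcP) hPk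
      hPbd).resolve_left h2
    have := h1.add h2
    rw [add_add_add_comm, ZModModule.add_self, add_zero, hsum] at this
    exact hnz₁ this

end

/-- The union of all edges of `KFive` other than `s`. -/
def otherEdges (s : Finset (Fin 5)) : Set KFive :=
  ⋃ t ∈ {t : Finset (Fin 5) | t.card = 2 ∧ t ≠ s}, face t

lemma isClosed_otherEdges (s : Finset (Fin 5)) : IsClosed (otherEdges s) :=
  (Set.toFinite _).isClosed_biUnion fun t _ => isClosed_face t

lemma face_subset_otherEdges {s t : Finset (Fin 5)} (ht : t.card = 2) (h : t ≠ s) :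
    face t ⊆ otherEdges s :=
  subset_biUnion_of_mem (u := face)
    (show t ∈ {t : Finset (Fin 5) | t.card = 2 ∧ t ≠ s} from ⟨ht, h⟩)

lemma face_union_otherEdges (s : Finset (Fin 5)) : face s ∪ otherEdges s = univ := by
  refine eq_univ_of_forall fun x => ?_
  obtain ⟨i, j, hij, hx⟩ := exists_face_of_mem x
  by_cases h : {i, j} = s
  · exact Or.inl (h ▸ hx)
  · exact Or.inr (face_subset_otherEdges (Finset.card_pair hij) h hx)

/-- The circle in `KFive` formed by an edge and the two edges joining it to the last vertex. -/
def triangle (s : Finset (Fin 5)) : Set KFive := face s ∪ ⋃ i ∈ s, face {i, 4}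

lemma triangle_subset_otherEdges {s t : Finset (Fin 5)} (hs : s.card = 2) (hs4 : 4 ∉ s)
    (ht4 : 4 ∉ t) (h : s ≠ t) : triangle s ⊆ otherEdges t := by
  refine union_subset (face_subset_otherEdges hs h) (iUnion₂_subset fun i hi => ?_)
  exact face_subset_otherEdges (Finset.card_pair (by rintro rfl; exact hs4 hi))
    (by rintro rfl; simp at ht4)

section

variable {F : KFive × Circle → Fin 3 → ℝ}

lemma exists_edge_cycle (hF : Continuous F) (hinj : Function.Injective F) {s : Finset (Fin 5)}
    (hs : s.card = 2) (hs4 : 4 ∉ s) :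
    ∃ δ ∈ offC (range F), IsFin δ ∧ proj 0 δ = δ ∧
      IsBd (F '' (otherEdges s ×ˢ univ)) δ ∧ ¬ IsBd (F '' (triangle s ×ˢ univ)) δ := by
  obtain ⟨i, j, hij, rfl⟩ := Finset.card_eq_two.1 hs
  simp only [Finset.mem_insert, Finset.mem_singleton, not_or] at hs4
  have hi : ({i, 4} : Finset (Fin 5)) ≠ {i, j} := fun h => by
    have : (4 : Fin 5) ∈ ({i, j} : Finset (Fin 5)) := h ▸ by simp
    simp [hs4] at this
  have hj : ({j, 4} : Finset (Fin 5)) ≠ {i, j} := fun h => by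
    have : (4 : Fin 5) ∈ ({i, j} : Finset (Fin 5)) := h ▸ by simp
    simp [hs4] at this
  have hci := Finset.card_pair (Ne.symm hs4.1)
  have hcj := Finset.card_pair (Ne.symm hs4.2)
  have hPS : face {i, 4} ∪ face {j, 4} ⊆ otherEdges {i, j} :=
    union_subset (face_subset_otherEdges hci hi) (face_subset_otherEdges hcj hj)
  have hCP : face {i} ∪ face {j} ⊆ face {i, 4} ∪ face {j, 4} :=
    union_subset_union (face_mono (by simp)) (face_mono (by simp))
  have hES : face {i, j} ∩ otherEdges {i, j} = face {i} ∪ face {j} := by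
    refine Subset.antisymm ?_ (subset_inter (union_subset (face_mono (by simp))
      (face_mono (by simp))) (hCP.trans hPS))
    rintro x ⟨hx, hx'⟩
    obtain ⟨t, ⟨ht, hne⟩, hxt⟩ := mem_iUnion₂.1 hx'
    have hxi : x ∈ face ({i, j} ∩ t) := face_inter _ _ ▸ ⟨hx, hxt⟩
    by_cases hit : i ∈ t
    · by_cases hjt : j ∈ t
      · refine absurd (Finset.eq_of_subset_of_card_le (s := {i, j}) ?_ (by rw [ht, hs])).symm hne
        simp [Finset.insert_subset_iff, hit, hjt]
      · exact Or.inl (face_mono (by intro k; simp; rintro (rfl | rfl) h <;> tauto) hxi)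
    · exact Or.inr (face_mono (by intro k; simp; rintro (rfl | rfl) h <;> tauto) hxi)
  have h := exists_linking_cycle hF hinj (isClosed_face {i, j})
    ((isClosed_face {i, 4}).union (isClosed_face {j, 4})) (isClosed_otherEdges {i, j})
    (isClosed_face {i}) (isClosed_face {j}) (acT_face_pair hF hinj hij)
    (acT_face_union hF hinj hci hcj ?_) (acT_face_singleton hF hinj i)
    (acT_face_singleton hF hinj j) hPS hES hCP ?_
  · rw [face_union_otherEdges, univ_prod_univ, image_univ] at h
    convert h using 9
    simp [triangle]
  · rw [show ({i, 4} ∩ {j, 4} : Finset (Fin 5)) = {4} by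
      ext k; simp; constructor
      · rintro ⟨rfl | h, rfl | h'⟩ <;> tauto
      · tauto, Finset.card_singleton]
  · rw [disjoint_iff_inter_eq_empty, face_inter, Finset.singleton_inter_of_notMem (by simpa),
      face_empty]

/-- The bounded components of the complement of a set. -/
def boundedComponents (X : Set (Fin 3 → ℝ)) : Set (Set (Fin 3 → ℝ)) :=
  {C | Bornology.IsBounded C ∧ ∃ p ∈ Xᶜ, C = connectedComponentIn Xᶜ p}

/-- The boundaries of chains in the complement of `A`. -/
def bdSub (A : Set (Fin 3 → ℝ)) : Submodule (ZMod 2) DyadicChain := (offC A).map bd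

lemma mem_bdSub {A : Set (Fin 3 → ℝ)} {z : DyadicChain} : z ∈ bdSub A ↔ IsBd A z := Iff.rfl

lemma exists_vtx_mem_of_isOpen {U : Set (Fin 3 → ℝ)} (hU : IsOpen U) (h : U.Nonempty) :
    ∃ n b, pt n b ∈ U := by
  obtain ⟨p, hp⟩ := h
  obtain ⟨n, hn⟩ := ((tendsto_pt_rnd p).eventually (hU.mem_nhds hp)).exists
  exact ⟨n, _, hn⟩

/-- Finite cycles of degree zero are spanned, modulo boundaries, by the bounded components. -/
lemma exists_spanning {X : Set (Fin 3 → ℝ)} (hX : IsCompact X) :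
    ∃ g : boundedComponents X → DyadicChain, ∀ z ∈ offC X, IsFin z → proj 0 z = z →
      (bdSub X).mkQ z ∈ Submodule.span (ZMod 2) (range fun C => (bdSub X).mkQ (g C)) := by
  have hopen (p : Fin 3 → ℝ) : IsOpen (connectedComponentIn Xᶜ p) :=
    hX.isClosed.isOpen_compl.connectedComponentIn
  have hdisj (p : Fin 3 → ℝ) : Disjoint (connectedComponentIn Xᶜ p) X :=
    disjoint_left.2 fun q hq => connectedComponentIn_subset _ _ hq
  have h (C : boundedComponents X) : ∃ n b, pt n b ∈ C.1 := by
    obtain ⟨C, -, p, hp, rfl⟩ := C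
    exact exists_vtx_mem_of_isOpen (hopen p) ⟨p, mem_connectedComponentIn hp⟩
  choose n b hb using h
  refine ⟨fun C => vtx (n C) (b C), fun z hz hfin hz0 => ?_⟩
  obtain ⟨m, y, hy, hoff, rfl⟩ := hfin.exists_off hz
  rw [proj_lev] at hz0
  have hz0 := lev_injective m hz0
  have hsum : y = ∑ c ∈ hy.toFinset, Pi.single c 1 := by
    funext c
    rw [Finset.sum_apply]
    simp only [Pi.single_apply, Finset.sum_ite_eq, Finite.mem_toFinset, Function.mem_support]
    split_ifs with h
    · exact (by decide : ∀ a : ZMod 2, a ≠ 0 → a = 1) _ h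
    · exact not_not.1 h
  rw [hsum, map_sum, map_sum]
  refine Submodule.sum_mem _ fun c hc => ?_
  have hc : y c ≠ 0 := by simpa using hc
  have hdim : cellDim c = 0 := by
    by_contra h
    rw [← hz0, projC_apply, if_neg h] at hc
    exact hc rfl
  obtain ⟨b', rfl⟩ := exists_dbl_eq hdim
  have hpX : pt m b' ∈ Xᶜ := disjoint_left.1 (off_iff.1 hoff _ hc) (mem_cube_dbl.2 rfl)
  change (bdSub X).mkQ (vtx m b') ∈ _
  by_cases hbd : Bornology.IsBounded (connectedComponentIn Xᶜ (pt m b'))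
  · refine Submodule.subset_span ⟨⟨connectedComponentIn Xᶜ (pt m b'), hbd, pt m b', hpX, rfl⟩, ?_⟩
    refine (Submodule.Quotient.eq _).2 ?_
    rw [ZModModule.sub_eq_add]
    exact isBd_vtx_add_vtx hX.isClosed isPreconnected_connectedComponentIn (hdisj _)
      (hb ⟨connectedComponentIn Xᶜ (pt m b'), hbd, pt m b', hpX, rfl⟩) (mem_connectedComponentIn hpX)
  · rw [Submodule.mkQ_apply, (Submodule.Quotient.mk_eq_zero _).2]
    · exact zero_mem _
    · exact isBd_vtx_of_not_isBounded hX (hopen _) isPreconnected_connectedComponentIn (hdisj _)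
        (mem_connectedComponentIn hpX) hbd

/-- The complement of the image of `KFive × Circle` has at least six bounded components. -/
lemma six_le_encard (hF : Continuous F) (hinj : Function.Injective F) :
    6 ≤ (boundedComponents (range F)).encard := by
  classical
  by_contra! hlt
  have hfin : (boundedComponents (range F)).Finite := by
    rw [← encard_lt_top_iff]; exact hlt.trans (by decide)
  have := hfin.fintype
  obtain ⟨g, hg⟩ := exists_spanning (isCompact_range hF)
  have h (e : {s : Finset (Fin 5) // s.card = 2 ∧ 4 ∉ s}) :=
    exists_edge_cycle hF hinj e.2.1 e.2.2
  choose δ hoff hδ hδ0 hbd hnbd using h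
  have hli : LinearIndependent (ZMod 2) fun e => (bdSub (range F)).mkQ (δ e) := by
    rw [linearIndependent_iff']
    intro t c hc e he
    by_contra hne
    simp only [← map_smul, ← map_sum] at hc
    rw [Submodule.mkQ_apply, Submodule.Quotient.mk_eq_zero, mem_bdSub] at hc
    have hc := hc.anti (image_subset_range F (triangle e.1 ×ˢ univ))
    rw [← Finset.add_sum_erase _ _ he, (by decide : ∀ a : ZMod 2, a ≠ 0 → a = 1) _ hne,
      one_smul, ← mem_bdSub, Submodule.add_mem_iff_left] at hc
    · exact hnbd e hc
    · refine Submodule.sum_mem _ fun e' he' => Submodule.smul_mem _ _ ?_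
      exact (hbd e').anti (image_mono (prod_mono_left (triangle_subset_otherEdges e.2.1 e.2.2
        e'.2.2 fun h => (Finset.ne_of_mem_erase he') (Subtype.ext h.symm))))
  have h1 := linearIndependent_le_span_aux' _ hli _ (range_subset_iff.2 fun e =>
    hg (δ e) (hoff e) (hδ e) (hδ0 e))
  have h2 : Fintype.card {s : Finset (Fin 5) // s.card = 2 ∧ 4 ∉ s} = 6 := by decide
  rw [h2] at h1
  have h3 := h1.trans (Fintype.card_range_le _)
  rw [← Set.coe_fintypeCard] at hlt
  have : Fintype.card (boundedComponents (range F)) < 6 := by exact_mod_cast hlt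
  omega

end

/-- A nonempty open union of components of the complement of `X`. -/
structure IsRegion (X R : Set (Fin 3 → ℝ)) : Prop where
  isOpen : IsOpen R
  nonempty : R.Nonempty
  disjoint : Disjoint R X
  saturated : Saturated X R

lemma isRegion_connectedComponentIn {X : Set (Fin 3 → ℝ)} (hX : IsClosed X) {p : Fin 3 → ℝ}
    (hp : p ∈ Xᶜ) : IsRegion X (connectedComponentIn Xᶜ p) where
  isOpen := hX.isOpen_compl.connectedComponentIn
  nonempty := ⟨p, mem_connectedComponentIn hp⟩
  disjoint := disjoint_left.2 fun _ hq => connectedComponentIn_subset _ _ hq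
  saturated := by
    rintro C hC hd ⟨q, hqC, hq⟩
    rw [connectedComponentIn_eq hq]
    exact hC.subset_connectedComponentIn hqC (subset_compl_iff_disjoint_right.2 hd)

/-- The union of the unbounded components of the complement of `X`. -/
def outerRegion (X : Set (Fin 3 → ℝ)) : Set (Fin 3 → ℝ) :=
  {p | p ∈ Xᶜ ∧ ¬ Bornology.IsBounded (connectedComponentIn Xᶜ p)}

lemma exists_compl_outerRegion_subset {X : Set (Fin 3 → ℝ)} (hX : IsCompact X) :
    ∃ r, (outerRegion X)ᶜ ⊆ Metric.closedBall 0 r := by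
  obtain ⟨r, hr⟩ := hX.isBounded.subset_closedBall 0
  refine ⟨max r 0, fun p hp => ?_⟩
  by_contra hpr
  rw [mem_closedBall_zero_iff, not_le, max_lt_iff] at hpr
  have hout (t : ℝ) (ht : 1 ≤ t) : t • p ∈ Xᶜ := fun h => by
    have := hr h
    rw [mem_closedBall_zero_iff, norm_smul, Real.norm_of_nonneg (by linarith)] at this
    nlinarith
  refine hp ⟨by simpa using hout 1 le_rfl, fun hb => ?_⟩
  have hpre : IsPreconnected ((fun t : ℝ => t • p) '' Ici 1) :=
    isPreconnected_Ici.image _ (by fun_prop)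
  have hsub := hpre.subset_connectedComponentIn (x := p) (F := Xᶜ) ⟨1, by simp, by simp⟩
    (image_subset_iff.2 hout)
  obtain ⟨M, hM⟩ := (hb.subset hsub).exists_norm_le
  have h1 := hM _ ⟨1 + |M| / ‖p‖, by simp; positivity, rfl⟩
  rw [norm_smul, Real.norm_of_nonneg (by positivity), add_mul, div_mul_cancel₀ _ (by linarith)] at h1
  linarith [le_abs_self M]

lemma isRegion_outerRegion {X : Set (Fin 3 → ℝ)} (hX : IsCompact X) :
    IsRegion X (outerRegion X) where
  isOpen := by
    have : outerRegion X = ⋃ p ∈ outerRegion X, connectedComponentIn Xᶜ p := by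
      refine Subset.antisymm (fun p hp => mem_biUnion hp (mem_connectedComponentIn hp.1))
        (iUnion₂_subset fun p hp q hq => ⟨connectedComponentIn_subset _ _ hq, ?_⟩)
      rw [← connectedComponentIn_eq hq]
      exact hp.2
    rw [this]
    exact isOpen_biUnion fun p _ => hX.isClosed.isOpen_compl.connectedComponentIn
  nonempty := by
    obtain ⟨r, hr⟩ := exists_compl_outerRegion_subset hX
    by_contra h
    rw [not_nonempty_iff_eq_empty.1 h, compl_empty] at hr
    exact NormedSpace.unbounded_univ ℝ (Fin 3 → ℝ) (Metric.isBounded_closedBall.subset hr)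
  disjoint := disjoint_left.2 fun _ h => h.1
  saturated := by
    rintro C hC hd ⟨q, hqC, hq⟩ p hp
    have hCX := subset_compl_iff_disjoint_right.2 hd
    refine ⟨hCX hp, ?_⟩
    rw [← connectedComponentIn_eq (hC.subset_connectedComponentIn hqC hCX hp)]
    exact hq.2

lemma exists_regions {X : Set (Fin 3 → ℝ)} (hX : IsCompact X)
    (h6 : 6 ≤ (boundedComponents X).encard) :
    ∃ R : Option (Fin 6) → Set (Fin 3 → ℝ), (∀ a, IsRegion X (R a)) ∧
      Pairwise (fun a b => Disjoint (R a) (R b)) ∧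
      (∀ a, Bornology.IsBounded (R (some a))) ∧ Bornology.IsBounded (R none)ᶜ := by
  obtain ⟨S, hS, hcard⟩ := exists_subset_encard_eq h6
  have hfin : S.Finite := finite_of_encard_eq_coe (k := 6) hcard
  have hn : Nat.card S = 6 := by
    rw [Nat.card_coe_set_eq, Set.ncard, hcard]
    rfl
  have := hfin.to_subtype
  let e := (Finite.equivFinOfCardEq hn).symm
  have hcomp (a : Fin 6) := hS (e a).2
  have hcc {p q : Fin 3 → ℝ} (h : (connectedComponentIn Xᶜ p ∩ connectedComponentIn Xᶜ q).Nonempty) :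
      connectedComponentIn Xᶜ p = connectedComponentIn Xᶜ q := by
    obtain ⟨r, hr, hr'⟩ := h
    rw [connectedComponentIn_eq hr, connectedComponentIn_eq hr']
  have hout (a : Fin 6) : Disjoint (outerRegion X) (e a).1 := disjoint_left.2 fun q hq hqa => by
    obtain ⟨hb, p, hp, heq⟩ := hcomp a
    rw [heq] at hqa hb
    rw [connectedComponentIn_eq hqa] at hb
    exact hq.2 hb
  refine ⟨fun a => a.elim (outerRegion X) fun a => (e a).1, ?_, ?_, fun a => (hcomp a).1, ?_⟩
  · rintro (_ | a)
    · exact isRegion_outerRegion hX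
    · obtain ⟨-, p, hp, heq⟩ := hcomp a
      change IsRegion X (e a).1
      rw [heq]
      exact isRegion_connectedComponentIn hX.isClosed hp
  · rintro (_ | a) (_ | b) hab
    · exact absurd rfl hab
    · exact hout b
    · exact (hout a).symm
    · change Disjoint (e a).1 (e b).1
      by_contra h
      rw [not_disjoint_iff_nonempty_inter] at h
      refine hab (congrArg some (e.injective (Subtype.ext ?_)))
      obtain ⟨-, p, hp, heq⟩ := hcomp a
      obtain ⟨-, q, hq, heq'⟩ := hcomp b
      rw [heq, heq'] at h ⊢
      exact hcc h
  · obtain ⟨r, hr⟩ := exists_compl_outerRegion_subset hX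
    exact Metric.isBounded_closedBall.subset hr

lemma IsRegion.closure_subset {X R : Set (Fin 3 → ℝ)} (hX : IsClosed X) (h : IsRegion X R) :
    closure R ⊆ R ∪ X := by
  intro p hp
  by_contra hpn
  simp only [mem_union, not_or] at hpn
  obtain ⟨r, hr, hsub⟩ := Metric.isOpen_iff.1 hX.isOpen_compl p hpn.2
  refine hpn.1 (h.saturated _ (convex_ball p r).isPreconnected
    (subset_compl_iff_disjoint_right.1 hsub) ?_ (Metric.mem_ball_self hr))
  exact mem_closure_iff.1 hp _ Metric.isOpen_ball (Metric.mem_ball_self hr)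

lemma saturated_of_closure_subset {Y R : Set (Fin 3 → ℝ)} (ho : IsOpen R)
    (h : closure R ⊆ R ∪ Y) : Saturated Y R := fun _ hC hCY hne =>
  hC.subset_of_closure_inter_subset ho hne fun _ hx =>
    (h hx.1).resolve_right (disjoint_left.1 hCY hx.2)

/-- The boundary of a region cannot lie in a set with connected complement. -/
lemma not_htriv_of_closure_subset {Y R R' : Set (Fin 3 → ℝ)} (ho : IsOpen R) (hne : R.Nonempty)
    (hd : Disjoint R Y) (h : closure R ⊆ R ∪ Y) (ho' : IsOpen R') (hne' : R'.Nonempty)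
    (hd' : Disjoint R' Y) (hRR' : Disjoint R R')
    (hb : Bornology.IsBounded R ∨ Bornology.IsBounded Rᶜ) : ¬ Htriv 0 Y := by
  intro htriv
  have hsat := saturated_of_closure_subset ho h
  have key {U V : Set (Fin 3 → ℝ)} (hU : IsOpen U) (hUne : U.Nonempty) (hUY : Disjoint U Y)
      (hV : Bornology.IsBounded V) (hVs : Saturated Y V) (hUV : U ⊆ V) : False := by
    obtain ⟨n, b, hbU⟩ := exists_vtx_mem_of_isOpen hU hUne
    exact not_isBd_vtx hV hVs (hUV hbU) (htriv _ (vtx_mem_offC (disjoint_left.1 hUY hbU))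
      (proj_vtx n b) (bd_vtx n b))
  rcases hb with hb | hb
  · exact key ho hne hd hb hsat subset_rfl
  · refine key ho' hne' hd' hb (fun C hC hCY hCR q hq hqR => ?_)
      (subset_compl_iff_disjoint_left.2 hRR')
    obtain ⟨p, hp, hpR⟩ := hCR
    exact hpR (hsat C hC hCY ⟨q, hq, hqR⟩ hp)

section

lemma Gen.isBd_of_three {X D : Set (Fin 3 → ℝ)} (hX : IsCompact X) (hD : IsCompact D)
    {g z w : DyadicChain} (hg : Gen 1 (X ∩ D) g) (hz : proj 0 z = z) (hw : proj 0 w = w)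
    (hzX : IsBd X z) (hzD : IsBd D z) (hwX : IsBd X w) (hwD : IsBd D w) :
    IsBd (X ∪ D) z ∨ IsBd (X ∪ D) w ∨ IsBd (X ∪ D) (z + w) := by
  obtain ⟨a, ha, ha1, rfl⟩ := hzX.exists_proj hz
  obtain ⟨b, hb, hb1, hab⟩ := hzD.exists_proj hz
  obtain ⟨a', ha', ha1', rfl⟩ := hwX.exists_proj hw
  obtain ⟨b', hb', hb1', hab'⟩ := hwD.exists_proj hw
  have key {a b : DyadicChain} (ha : a ∈ offC X) (hb : b ∈ offC D) (ha1 : proj 1 a = a)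
      (hb1 : proj 1 b = b) (hab : bd b = bd a) := hg.span (a + b)
    (add_mem (offC_anti inter_subset_left ha) (offC_anti inter_subset_right hb))
    (by rw [map_add, ha1, hb1]) (by rw [map_add, hab, ZModModule.add_self])
  rcases key ha hb ha1 hb1 hab with h | h
  · exact Or.inl (exists_common_filling hX hD ha hb h)
  rcases key ha' hb' ha1' hb1' hab' with h' | h'
  · exact Or.inr (Or.inl (exists_common_filling hX hD ha' hb' h'))
  · have hs := h.add h'
    rw [add_add_add_comm, ZModModule.add_self, add_zero, add_add_add_comm] at hs
    rw [← map_add]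
    exact Or.inr (Or.inr (exists_common_filling hX hD (add_mem ha ha') (add_mem hb hb') hs))

lemma exists_vtx_near {Y D R : Set (Fin 3 → ℝ)} (hY : IsClosed Y) (hD : IsPreconnected D)
    (hDY : Disjoint D Y) (hR : IsOpen R) {p : Fin 3 → ℝ} (hpD : p ∈ D) (hp : p ∈ closure R) :
    ∃ n b C, pt n b ∈ R ∧ pt n b ∈ C ∧ D ⊆ C ∧ IsPreconnected C ∧ Disjoint C Y := by
  obtain ⟨r, hr, hsub⟩ := Metric.isOpen_iff.1 hY.isOpen_compl p (disjoint_left.1 hDY hpD)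
  obtain ⟨q, hq, hqR⟩ := mem_closure_iff.1 hp _ Metric.isOpen_ball (Metric.mem_ball_self hr)
  obtain ⟨n, b, hb, hbR⟩ := exists_vtx_mem_of_isOpen (Metric.isOpen_ball.inter hR) ⟨q, hq, hqR⟩
  exact ⟨n, b, D ∪ Metric.ball p r, hbR, Or.inr hb, subset_union_left,
    hD.union p hpD (Metric.mem_ball_self hr) (convex_ball p r).isPreconnected,
    disjoint_union_left.2 ⟨hDY, subset_compl_iff_disjoint_right.1 hsub⟩⟩

lemma isPreconnected_edge {i j : Fin 5} (hij : i ≠ j) {s t : ℝ} (h0 : 0 ≤ s) (h1 : t ≤ 1) :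
    IsPreconnected (face {i, j} ∩ {x : KFive | x.1 i ∈ Ioo s t}) := by
  refine Topology.IsInducing.subtypeVal.isPreconnected_image.1 ?_
  have : Subtype.val '' (face {i, j} ∩ {x : KFive | x.1 i ∈ Ioo s t}) =
      (fun r : ℝ => r • vert i + (1 - r) • vert j) '' Ioo s t := by
    ext x
    constructor
    · rintro ⟨x, ⟨hx, hxi⟩, rfl⟩
      refine ⟨x.1 i, hxi, funext fun k => ?_⟩
      have hs := coord_add_of_mem_face hij hx
      by_cases hki : k = i
      · subst hki; simp [vert, hij]
      by_cases hkj : k = j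
      · subst hkj; simp [vert, hki]; linarith
      · simp [vert, hki, hkj, hx k (by simp [hki, hkj])]
    · rintro ⟨r, hr, rfl⟩
      refine ⟨⟨_, mem_graphRealization_top.2 ⟨i, j, hij, r, 1 - r, h0.trans hr.1.le,
        by linarith [hr.2], by ring, rfl⟩⟩, ⟨fun k hk => ?_, ?_⟩, rfl⟩
      · simp only [Finset.mem_insert, Finset.mem_singleton, not_or] at hk
        simp [vert, hk.1, hk.2]
      · simpa [vert, hij] using hr
  rw [this]
  exact isPreconnected_Ioo.image _ (by fun_prop)

/-- The points of `KFive` with support `s`. -/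
def openEdge (s : Finset (Fin 5)) : Set KFive := {x ∈ face s | ∀ i ∈ s, 0 < x.1 i}

lemma notMem_otherEdges {s : Finset (Fin 5)} (hs : s.card = 2) {x : KFive}
    (hx : ∀ i ∈ s, 0 < x.1 i) : x ∉ otherEdges s := by
  intro h
  obtain ⟨t, ⟨ht, hne⟩, hxt⟩ := mem_iUnion₂.1 h
  refine hne (Finset.eq_of_subset_of_card_le (fun i hi => ?_) (by rw [ht, hs])).symm
  by_contra hit
  exact (hx i hi).ne' (hxt i hit)

lemma edge_decomposition (i j : Fin 5) (s t : ℝ) :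
    otherEdges {i, j} ∪ edgePart i j 0 s ∪ edgePart i j t 1 ∪ edgePart i j s t = univ := by
  refine eq_univ_of_forall fun x => ?_
  rcases (face_union_otherEdges {i, j}).symm ▸ mem_univ x with h | h
  · rcases le_total (x.1 i) s with hs | hs
    · exact Or.inl (Or.inl (Or.inr ⟨h, coord_nonneg x i, hs⟩))
    · rcases le_total (x.1 i) t with ht | ht
      · exact Or.inr ⟨h, hs, ht⟩
      · exact Or.inl (Or.inr ⟨h, ht, coord_le_one x i⟩)
  · exact Or.inl (Or.inl (Or.inl h))

lemma pos_of_mem_edge {i j : Fin 5} (hij : i ≠ j) {x : KFive} (hx : x ∈ face {i, j})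
    (h0 : 0 < x.1 i) (h1 : x.1 i < 1) : ∀ k ∈ ({i, j} : Finset (Fin 5)), 0 < x.1 k := by
  intro k hk
  have := coord_add_of_mem_face hij hx
  rcases Finset.mem_insert.1 hk with rfl | hk
  · exact h0
  · rw [Finset.mem_singleton.1 hk]; linarith

lemma exists_edge_ends {i j : Fin 5} (hij : i ≠ j) {s t : ℝ} (h0 : 0 < s) (hst : s < t)
    (h1 : t < 1) : ∃ x y, x ∈ edgePart i j s t ∧ y ∈ edgePart i j s t ∧ x ≠ y ∧
      (otherEdges {i, j} ∪ edgePart i j 0 s ∪ edgePart i j t 1) ∩ edgePart i j s t = {x, y} := by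
  obtain ⟨x, hx⟩ := exists_fibre_eq hij (r := s) ⟨h0.le, (hst.trans h1).le⟩
  obtain ⟨y, hy⟩ := exists_fibre_eq hij (r := t) ⟨(h0.trans hst).le, h1.le⟩
  obtain ⟨hxf, hxs⟩ : x ∈ face {i, j} ∧ x.1 i = s := hx.superset rfl
  obtain ⟨hyf, hyt⟩ : y ∈ face {i, j} ∧ y.1 i = t := hy.superset rfl
  have hxe : x ∈ edgePart i j s t := ⟨hxf, hxs.ge, hxs.le.trans hst.le⟩
  have hye : y ∈ edgePart i j s t := ⟨hyf, hst.le.trans hyt.ge, hyt.le⟩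
  refine ⟨x, y, hxe, hye, ?_, Subset.antisymm ?_ ?_⟩
  · rintro rfl
    linarith
  · rintro z ⟨hz, hzf, hzs, hzt⟩
    rcases hz with (hz | hz) | hz
    · exact absurd hz (notMem_otherEdges (Finset.card_pair hij)
        (pos_of_mem_edge hij hzf (h0.trans_le hzs) (hzt.trans_lt h1)))
    · exact Or.inl (hx.subset ⟨hzf, le_antisymm hz.2.2 hzs⟩)
    · exact Or.inr (hy.subset ⟨hzf, le_antisymm hzt hz.2.1⟩)
  · rintro z (rfl | rfl)
    · exact ⟨Or.inl (Or.inr ⟨hxf, h0.le.trans hxs.ge, hxs.le⟩), hxe⟩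
    · exact ⟨Or.inr ⟨hyf, hyt.ge, hyt.le.trans h1.le⟩, hye⟩

instance : Infinite Circle :=
  have : Infinite (Icc (0 : ℝ) 1) := (Icc_infinite zero_lt_one).to_subtype
  Infinite.of_injective (fun x : Icc (0 : ℝ) 1 => Circle.exp x) fun x y h =>
    Subtype.ext (Circle.exp_injOn_Ico (show (0 : ℝ) + 2 * Real.pi - 0 ≤ 2 * Real.pi by linarith)
      ⟨x.2.1, by linarith [x.2.2, Real.pi_gt_three]⟩
      ⟨y.2.1, by linarith [y.2.2, Real.pi_gt_three]⟩ h)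

lemma exists_Ioo_of_finite {ι : Type*} [Finite ι] {l u : ℝ} (hlu : l < u) (f : ι → ℝ)
    (hf : ∀ k, f k ∈ Ioo l u) : ∃ s t, l < s ∧ s < t ∧ t < u ∧ ∀ k, f k ∈ Ioo s t := by
  have h1 : ∀ᶠ s in nhdsWithin l (Ioi l), s ∈ Ioo l u ∧ ∀ k, s < f k :=
    Filter.Eventually.and (Ioo_mem_nhdsGT hlu) (Filter.eventually_all.2 fun k =>
      (Filter.mem_of_superset (Ioo_mem_nhdsGT (hf k).1) fun s hs => hs.2))
  obtain ⟨s, hs, hsf⟩ := h1.exists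
  have h2 : ∀ᶠ t in nhdsWithin u (Iio u), t ∈ Ioo s u ∧ ∀ k, f k < t :=
    Filter.Eventually.and (Ioo_mem_nhdsLT hs.2) (Filter.eventually_all.2 fun k =>
      (Filter.mem_of_superset (Ioo_mem_nhdsLT (hf k).2) fun t ht => ht.1))
  obtain ⟨t, ht, htf⟩ := h2.exists
  exact ⟨s, t, hs.1, ht.1, ht.2, fun k => ⟨hsf k, htf k⟩⟩

lemma exists_arc_of_finite {ι : Type*} [Finite ι] (θ : ι → Circle) :
    ∃ a b, a < b ∧ b < a + 2 * Real.pi ∧ ∀ k, θ k ∈ Circle.exp '' Ioo a b := by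
  obtain ⟨θ', hθ⟩ := (finite_range θ).infinite_compl.nonempty
  obtain ⟨c, rfl⟩ := Circle.exp_surjective θ'
  choose t h0 h1 ht using fun k => exists_exp_eq c (θ k)
  have hlt (k : ι) : c < t k := lt_of_le_of_ne (h0 k) fun h => hθ ⟨k, by rw [h, ht]⟩
  obtain ⟨a, b, ha, hab, hb, h⟩ := exists_Ioo_of_finite
    (show c < c + 2 * Real.pi by linarith [Real.pi_pos]) t fun k => ⟨hlt k, h1 k⟩
  exact ⟨a, b, hab, by linarith, fun k => ⟨t k, h k, ht k⟩⟩

lemma exp_notMem_arc {a b u : ℝ} (hu : u ∈ Ioo a b) (hb : b < a + 2 * Real.pi) :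
    Circle.exp u ∉ arc b (a + 2 * Real.pi) := by
  rw [← Circle.periodic_exp u, mem_arc_iff (by linarith [hu.1]) (by linarith [hu.2])
    (by linarith [hu.1, hu.2])]
  linarith [hu.1]

variable {F : KFive × Circle → Fin 3 → ℝ}

/-- An edge is in the boundary of at most two regions. -/
lemma false_of_three_regions (hF : Continuous F) (hinj : Function.Injective F) {s : Finset (Fin 5)}
    (hs : s.card = 2) (R : Fin 3 → Set (Fin 3 → ℝ)) (hR : ∀ k, IsRegion (range F) (R k))
    (hsep : ∀ k l, k ≠ l → ∀ n b m b', pt n b ∈ R k → pt m b' ∈ R l →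
      ¬ IsBd (range F) (vtx n b + vtx m b'))
    (h : ∀ k, (closure (R k) ∩ F '' (openEdge s ×ˢ univ)).Nonempty) : False := by
  obtain ⟨i, j, hij, rfl⟩ := Finset.card_eq_two.1 hs
  choose p hpR q hq hqp using h
  obtain ⟨s, t, h0, hst, h1, hI⟩ := exists_Ioo_of_finite zero_lt_one (fun k => (q k).1.1 i)
    fun k => ⟨(hq k).1.2 i (by simp), by
      have := coord_add_of_mem_face hij (hq k).1.1
      linarith [(hq k).1.2 j (by simp)]⟩
  obtain ⟨a, b, hab, hlt, hθ⟩ := exists_arc_of_finite fun k => (q k).2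
  obtain ⟨x, y, hx, hy, hxy, hends⟩ := exists_edge_ends hij h0 hst h1
  set J := edgePart i j s t with hJ
  set T := otherEdges {i, j} ∪ edgePart i j 0 s ∪ edgePart i j t 1 with hT
  have hJc : IsClosed J := isClosed_edgePart ..
  have hTc : IsClosed T := ((isClosed_otherEdges _).union (isClosed_edgePart ..)).union
    (isClosed_edgePart ..)
  have hJa : AcT F J := acT_edgePart hF hinj hij h0.le hst.le h1.le
  obtain ⟨hau, hai⟩ := arc_union_and_inter_complement hlt hab.le
  set b' := a + 2 * Real.pi
  set X := F '' (T ×ˢ univ ∪ univ ×ˢ arc b b') with hX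
  set D := F '' (J ×ˢ arc a b) with hD
  have hXc : IsCompact X := (((hTc.prod isClosed_univ).union
    (isClosed_univ.prod (isClosed_arc b b'))).isCompact).image hF
  have hDc : IsCompact D := isCompact_prod_image hF hJc (isClosed_arc a b)
  have hXD : X ∪ D = range F := by
    rw [hX, hD, ← image_union, ← image_univ]
    congr 1
    refine eq_univ_of_forall fun ⟨z, θ⟩ => ?_
    rcases hau.symm ▸ mem_univ θ with hθ | hθ
    · rcases (edge_decomposition i j s t).symm ▸ mem_univ z with hz | hz
      · exact Or.inl (Or.inl ⟨hz, trivial⟩)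
      · exact Or.inr ⟨hz, hθ⟩
    · exact Or.inl (Or.inr ⟨trivial, hθ⟩)
  have hXiD : X ∩ D = F '' ({x, y} ×ˢ arc a b ∪ J ×ˢ (arc a a ∪ arc b b)) := by
    rw [hX, hD, ← image_inter hinj, union_inter_distrib_right, prod_inter_prod, prod_inter_prod,
      hends, univ_inter, univ_inter, inter_comm, hai]
  obtain ⟨g, hg⟩ := exists_gen_boundary hF hinj hJc hJa hx hy hxy hab hlt
  rw [← hXiD] at hg
  set D' := F '' ((face {i, j} ∩ {x : KFive | x.1 i ∈ Ioo s t}) ×ˢ (Circle.exp '' Ioo a b))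
    with hD'
  have hD'pre : IsPreconnected D' := ((isPreconnected_edge hij h0.le h1.le).prod
    (isPreconnected_Ioo.image _ Circle.exp.continuous.continuousOn)).image _ hF.continuousOn
  have hD'X : Disjoint D' X := by
    rw [hD', hX, disjoint_image_iff hinj, disjoint_left]
    rintro ⟨z, _⟩ ⟨⟨hz, hzI⟩, u, hu, rfl⟩ (⟨hzT, -⟩ | ⟨-, hu'⟩)
    · rcases hzT with (hzT | hzT) | hzT
      · exact notMem_otherEdges (Finset.card_pair hij)
          (pos_of_mem_edge hij hz (h0.trans hzI.1) (hzI.2.trans h1)) hzT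
      · exact hzT.2.2.not_gt hzI.1
      · exact hzT.2.1.not_gt hzI.2
    · exact exp_notMem_arc hu hlt hu'
  have hpD' (k : Fin 3) : p k ∈ D' := ⟨q k, ⟨⟨(hq k).1.1, hI k⟩, hθ k⟩, hqp k⟩
  choose n c C hcR hcC hDC hCpre hCX using fun k =>
    exists_vtx_near hXc.isClosed hD'pre hD'X (hR k).isOpen (hpD' k) (hpR k)
  have hbX (k l : Fin 3) : IsBd X (vtx (n k) (c k) + vtx (n l) (c l)) :=
    isBd_vtx_add_vtx hXc.isClosed ((hCpre k).union (p k) (hDC k (hpD' k)) (hDC l (hpD' k)) (hCpre l))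
      (disjoint_union_left.2 ⟨hCX k, hCX l⟩) (Or.inl (hcC k)) (Or.inr (hcC l))
  have hp0 (k l : Fin 3) : proj 0 (vtx (n k) (c k) + vtx (n l) (c l)) =
      vtx (n k) (c k) + vtx (n l) (c l) := by rw [map_add, proj_vtx, proj_vtx]
  have hcD (k : Fin 3) : pt (n k) (c k) ∉ D :=
    fun h => disjoint_left.1 (hR k).disjoint (hcR k) (image_subset_range _ _ h)
  have hbD (k l : Fin 3) : IsBd D (vtx (n k) (c k) + vtx (n l) (c l)) :=
    hJa a b hab.le hlt 0 _ (add_mem (vtx_mem_offC (hcD k)) (vtx_mem_offC (hcD l))) (hp0 k l)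
      (by rw [map_add, bd_vtx, bd_vtx, add_zero])
  have h3 := hg.isBd_of_three hXc hDc (hp0 0 1) (hp0 0 2) (hbX 0 1) (hbD 0 1) (hbX 0 2) (hbD 0 2)
  rw [hXD, add_add_add_comm, ZModModule.add_self, zero_add] at h3
  rcases h3 with h3 | h3 | h3
  · exact hsep 0 1 (by decide) _ _ _ _ (hcR 0) (hcR 1) h3
  · exact hsep 0 2 (by decide) _ _ _ _ (hcR 0) (hcR 2) h3
  · exact hsep 1 2 (by decide) _ _ _ _ (hcR 1) (hcR 2) h3

/-- A region has at least three edges in its boundary. -/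
lemma IsRegion.three_le_card (hF : Continuous F) (hinj : Function.Injective F)
    {R R' : Set (Fin 3 → ℝ)} (hR : IsRegion (range F) R) (hR' : IsRegion (range F) R')
    (hd : Disjoint R R') (hb : Bornology.IsBounded R ∨ Bornology.IsBounded Rᶜ)
    {E : Finset (Finset (Fin 5))} (hE : ∀ s, s.card = 2 →
      (closure R ∩ F '' (openEdge s ×ˢ univ)).Nonempty → s ∈ E) : 3 ≤ E.card := by
  by_contra! hlt
  obtain ⟨s, t, hs, ht, hst, hsub⟩ : ∃ s t : Finset (Fin 5), s.card = 2 ∧ t.card = 2 ∧ s ≠ t ∧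
      ∀ u ∈ E, u.card = 2 → u = s ∨ u = t := by
    obtain ⟨U, hEU, hU, hU2⟩ := Finset.exists_subsuperset_card_eq (n := 2)
      (s := E.filter fun u => u.card = 2) (t := Finset.powersetCard 2 Finset.univ)
      (fun u hu => Finset.mem_powersetCard_univ.2 (Finset.mem_filter.1 hu).2)
      ((Finset.card_filter_le _ _).trans (by omega)) (by simp [Nat.choose])
    obtain ⟨s, t, hst, rfl⟩ := Finset.card_eq_two.1 hU2
    refine ⟨s, t, Finset.mem_powersetCard_univ.1 (hU (by simp)),
      Finset.mem_powersetCard_univ.1 (hU (by simp)), hst, fun u hu hu2 => ?_⟩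
    simpa using hEU (Finset.mem_filter.2 ⟨hu, hu2⟩)
  have hYX : F '' ((face s ∪ face t ∪ ⋃ i ∈ Finset.univ, face {i}) ×ˢ univ) ⊆ range F :=
    image_subset_range _ _
  refine not_htriv_of_closure_subset hR.isOpen hR.nonempty (hR.disjoint.mono_right hYX) ?_
    hR'.isOpen hR'.nonempty (hR'.disjoint.mono_right hYX) hd hb
    (htriv_zero_two_edges hF hinj hs ht hst Finset.univ)
  intro p hp
  refine (hR.closure_subset (isCompact_range hF).isClosed hp).imp_right ?_
  rintro ⟨⟨x, θ⟩, rfl⟩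
  refine mem_image_of_mem F ⟨?_, trivial⟩
  obtain ⟨i, j, hij, hx⟩ := exists_face_of_mem x
  by_cases h : ∀ k ∈ ({i, j} : Finset (Fin 5)), 0 < x.1 k
  · have hc := Finset.card_pair hij
    rcases hsub _ (hE _ hc ⟨_, hp, (x, θ), ⟨⟨hx, h⟩, trivial⟩, rfl⟩) hc with rfl | rfl
    · exact Or.inl (Or.inl hx)
    · exact Or.inl (Or.inr hx)
  · push Not at h
    obtain ⟨k, hk, hk0⟩ := h
    have hk0 := hk0.antisymm (coord_nonneg x k)
    refine Or.inr (mem_iUnion₂.2 ?_)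
    rcases Finset.mem_insert.1 hk with rfl | hk
    · refine ⟨j, Finset.mem_univ j, fun l hl => ?_⟩
      by_cases hlk : l = k
      · rwa [hlk]
      · exact hx l (by simp_all)
    · rw [Finset.mem_singleton] at hk
      subst hk
      refine ⟨i, Finset.mem_univ i, fun l hl => ?_⟩
      by_cases hlk : l = k
      · rwa [hlk]
      · exact hx l (by simp_all)

lemma not_isBd_of_isRegion {X R R' : Set (Fin 3 → ℝ)} (hR : IsRegion X R) (hR' : IsRegion X R')
    (hd : Disjoint R R') (hb : Bornology.IsBounded R ∨ Bornology.IsBounded R') {n m : ℕ}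
    {b b' : Fin 3 → ℤ} (h : pt n b ∈ R) (h' : pt m b' ∈ R') :
    ¬ IsBd X (vtx n b + vtx m b') := by
  rcases hb with hb | hb
  · exact not_isBd_vtx_add_vtx hb hR.saturated h (disjoint_right.1 hd h')
  · rw [add_comm]
    exact not_isBd_vtx_add_vtx hb hR'.saturated h' (disjoint_left.1 hd h)

/-- `KFive × Circle` does not embed in three-dimensional space. -/
theorem not_injective_of_continuous (hF : Continuous F) : ¬ Function.Injective F := by
  classical
  intro hinj
  obtain ⟨R, hR, hd, hb, hb'⟩ := exists_regions (isCompact_range hF) (six_le_encard hF hinj)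
  let adj (a : Option (Fin 6)) (s : Finset (Fin 5)) : Prop :=
    (closure (R a) ∩ F '' (openEdge s ×ˢ univ)).Nonempty
  have h := Finset.sum_card_bipartiteAbove_eq_sum_card_bipartiteBelow adj
    (s := Finset.univ) (t := Finset.powersetCard 2 Finset.univ)
  have h3 (a : Option (Fin 6)) :
      3 ≤ ((Finset.powersetCard 2 Finset.univ).bipartiteAbove adj a).card := by
    obtain ⟨a', ha'⟩ := exists_ne a
    refine (hR a).three_le_card hF hinj (hR a') (hd ha'.symm) ?_ fun s hs hadj => ?_
    · cases a with
      | none => exact Or.inr hb'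
      | some a => exact Or.inl (hb a)
    · exact Finset.mem_filter.2 ⟨Finset.mem_powersetCard.2 ⟨Finset.subset_univ s, hs⟩, hadj⟩
  have h2 : ∀ s ∈ Finset.powersetCard 2 Finset.univ,
      (Finset.univ.bipartiteBelow adj s).card ≤ 2 := by
    intro s hs
    by_contra! hlt
    let e : Fin 3 → Option (Fin 6) := fun k =>
      (Finset.equivFin (Finset.univ.bipartiteBelow adj s)).symm (Fin.castLE hlt k)
    have he : Function.Injective e := Subtype.val_injective.comp
      ((Equiv.injective _).comp (Fin.castLE_injective hlt))
    have hadj (k : Fin 3) : adj (e k) s := (Finset.mem_filter.1 (Finset.coe_mem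
      ((Finset.equivFin (Finset.univ.bipartiteBelow adj s)).symm (Fin.castLE hlt k)))).2
    refine false_of_three_regions hF hinj (Finset.mem_powersetCard_univ.1 hs) (R ∘ e)
      (fun k => hR _) (fun k l hkl n b m b' h h' =>
        not_isBd_of_isRegion (hR (e k)) (hR (e l)) (hd (he.ne hkl)) ?_ h h')
      hadj
    rcases hk : e k with _ | a
    · rcases hl : e l with _ | a
      · exact absurd (he (hk.trans hl.symm)) hkl
      · exact Or.inr (hb a)
    · exact Or.inl (hb a)
  have h4 := Finset.card_nsmul_le_sum Finset.univ _ 3 fun a _ => h3 a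
  have h5 := Finset.sum_le_card_nsmul _ _ 2 h2
  rw [h] at h4
  have := h4.trans h5
  simp [Finset.card_powersetCard] at this
  norm_num [Nat.choose] at this

end

/-- If `K₅ × S¹` embeds into `ℝ³` then `K₅ × K₅` embeds into `ℝ⁴`; consequently (since
`K₅ × K₅` does not embed into `ℝ⁴`), `K₅ × S¹` does not embed into `ℝ³`. -/
theorem K5_times_circle_not_embeddable :
    ((∃ f : ↥(graphRealization (⊤ : SimpleGraph (Fin 5))) × Circle →
        EuclideanSpace ℝ (Fin 3), Topology.IsEmbedding f) →
      (∃ g : ↥(graphRealization (⊤ : SimpleGraph (Fin 5))) ×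
          ↥(graphRealization (⊤ : SimpleGraph (Fin 5))) →
          EuclideanSpace ℝ (Fin 4), Topology.IsEmbedding g)) ∧
    ¬ (∃ f : ↥(graphRealization (⊤ : SimpleGraph (Fin 5))) × Circle →
        EuclideanSpace ℝ (Fin 3), Topology.IsEmbedding f) := by
  suffices h : ¬ ∃ f : KFive × Circle → EuclideanSpace ℝ (Fin 3), Topology.IsEmbedding f from
    ⟨fun hf => absurd hf h, h⟩
  rintro ⟨f, hf⟩
  exact not_injective_of_continuous (F := fun p => WithLp.ofLp (f p))
    ((PiLp.continuous_ofLp 2 _).comp hf.continuous) ((WithLp.ofLp_injective 2).comp hf.injective)
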